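/- Let d≥2 and m∈{1,…,d} be integers, let d_1,…,d_m be positive integers with d_1+…+d_m=d, and let β_1,…,β_m≥0. Let X_1,…,X_n be i.i.d. block-beta distributed random points in Z_𝕕=B_2^{d_1}×…×B_2^{d_m} and P_n^β=conv{X_1,…,X_n}. Set k_i=(d_i+β_i)/(1+β_i), k_max=max_i k_i and #k_max=#{i : k_i=k_max}. Then for every j∈{⌊d/2⌋−1,…,d−1}, E f_j(P_n^β) ≍ n^{(k_max−1)/(k_max+1)} (ln n)^{#k_max−1}, with implied constants depending only on (d_1,…,d_m) and (β_1,…,β_m). -/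

import Mathlib

open MeasureTheory Filter

noncomputable section

/-- Normalizing constant `c_{β,k}` of the beta density on the unit ball of `ℝ^k`. -/
def betaConst (β : ℝ) (k : ℕ) : ℝ :=
  Real.Gamma ((k : ℝ) / 2 + β + 1) / (Real.pi ^ ((k : ℝ) / 2) * Real.Gamma (β + 1))

/-- The beta density with parameter `β` on the unit ball of `ℝ^k` (extended by `0`). -/
def betaDensity (β : ℝ) (k : ℕ) (y : EuclideanSpace ℝ (Fin k)) : ℝ :=
  if ‖y‖ ≤ 1 then betaConst β k * (1 - ‖y‖ ^ 2) ^ β else 0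

/-- The beta probability distribution with parameter `β` on the unit ball of `ℝ^k`. -/
def betaMeasure (β : ℝ) (k : ℕ) : Measure (EuclideanSpace ℝ (Fin k)) :=
  volume.withDensity fun y => ENNReal.ofReal (betaDensity β k y)

/-- The block-beta distribution on `Z_𝕕 = B_2^{d_1} × ⋯ × B_2^{d_m}`: the block
coordinates are independent and the `i`-th block is beta distributed with parameter `β i`. -/
def blockBetaMeasure {m : ℕ} (dv : Fin m → ℕ) (βv : Fin m → ℝ) :
    Measure (Π i, EuclideanSpace ℝ (Fin (dv i))) :=
  Measure.pi fun i => betaMeasure (βv i) (dv i)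

/-- The number of `j`-dimensional faces of a convex body `K`: faces are the nonempty
convex extreme subsets of `K`, and the dimension of a face is the dimension of its
affine hull. -/
def faceCount {E : Type*} [AddCommGroup E] [Module ℝ E] (K : Set E) (j : ℕ) : ℕ :=
  Nat.card {F : Set E // F.Nonempty ∧ Convex ℝ F ∧ IsExtreme ℝ K F ∧
    Module.finrank ℝ (vectorSpan ℝ F) = j}

/-- Expected number of `j`-dimensional faces of the convex hull of `n` i.i.d.
block-beta distributed random points. -/
def expectedFaceCount {m : ℕ} (dv : Fin m → ℕ) (βv : Fin m → ℝ) (j n : ℕ) : ℝ :=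
  ∫ x : Fin n → Π i, EuclideanSpace ℝ (Fin (dv i)),
    (faceCount (convexHull ℝ (Set.range x)) j : ℝ)
    ∂(Measure.pi fun _ : Fin n => blockBetaMeasure dv βv)

section Polytope

open Module

variable {E : Type*} [NormedAddCommGroup E] [NormedSpace ℝ E] {ι : Type*}

/-- The points indexed by `J` are cut out of the family `x` by a supporting hyperplane. -/
def IsExposedIndexSet (x : ι → E) (J : Finset ι) : Prop :=
  ∃ f : E →L[ℝ] ℝ, ∃ c : ℝ, (∀ i ∈ J, f (x i) = c) ∧ ∀ i ∉ J, f (x i) < c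

/-- No point of the family lies in the affine span of at most `finrank ℝ E` other points. -/
def InGeneralPosition (x : ι → E) : Prop :=
  ∀ i, ∀ J : Finset ι, i ∉ J → J.card ≤ finrank ℝ E → x i ∉ affineSpan ℝ (x '' J)

theorem mem_convexHull_range_iff_weights [Fintype ι] (x : ι → E) (y : E) :
    y ∈ convexHull ℝ (Set.range x) ↔
      ∃ w : ι → ℝ, (∀ i, 0 ≤ w i) ∧ ∑ i, w i = 1 ∧ ∑ i, w i • x i = y := by
  constructor
  · intro h
    rw [convexHull_range_eq_exists_affineCombination] at h
    obtain ⟨s, w, h0, h1, rfl⟩ := h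
    classical
    refine ⟨fun i => if i ∈ s then w i else 0, fun i => ?_, ?_, ?_⟩
    · dsimp only
      split_ifs with hi
      · exact h0 i hi
      · exact le_rfl
    · rw [← h1]
      simp
    · rw [Finset.affineCombination_eq_linear_combination _ _ _ h1]
      simp [ite_smul]
  · rintro ⟨w, h0, h1, rfl⟩
    exact mem_convexHull_of_exists_fintype w x h0 h1 (fun i => ⟨i, rfl⟩) rfl

theorem weights_mem_convexHull_image [Fintype ι] (x : ι → E) (J : Finset ι) (w : ι → ℝ)
    (h0 : ∀ i, 0 ≤ w i) (h1 : ∑ i, w i = 1) (hJ : ∀ i ∉ J, w i = 0) :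
    ∑ i, w i • x i ∈ convexHull ℝ (x '' J) := by
  have hs : ∑ i ∈ J, w i = 1 := by
    rw [← h1]
    exact Finset.sum_subset (Finset.subset_univ _) fun i _ hi => hJ i hi
  have := J.centerMass_mem_convexHull (R := ℝ) (s := x '' J) (z := x) (fun i _ => h0 i)
    (by rw [hs]; exact one_pos) (fun i hi => ⟨i, hi, rfl⟩)
  rw [Finset.centerMass_eq_of_sum_1 _ _ hs] at this
  convert this using 1
  symm
  exact Finset.sum_subset (Finset.subset_univ _) fun i _ hi => by rw [hJ i hi, zero_smul]

/-- A convex extreme subset of a polytope is the convex hull of the vertices it contains. -/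
theorem IsExtreme.eq_convexHull_image [Fintype ι] {x : ι → E} {F : Set E}
    (hF : IsExtreme ℝ (convexHull ℝ (Set.range x)) F) (hc : Convex ℝ F) (J : Finset ι)
    (hJ : ∀ i, i ∈ J ↔ x i ∈ F) : F = convexHull ℝ (x '' J) := by
  classical
  apply Set.Subset.antisymm
  · intro y hy
    obtain ⟨w, h0, h1, rfl⟩ := (mem_convexHull_range_iff_weights x y).1 (hF.subset hy)
    refine weights_mem_convexHull_image x J w h0 h1 fun i hi => ?_
    by_contra hne
    apply hi
    rw [hJ]
    have hpos : 0 < w i := lt_of_le_of_ne (h0 i) (Ne.symm hne)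
    have hle : w i ≤ 1 := by
      rw [← h1]; exact Finset.single_le_sum (fun j _ => h0 j) (Finset.mem_univ i)
    set s := w i / 2 with hs
    have hs0 : 0 < s := by positivity
    have hs1 : s < 1 := by linarith
    let q : E := ∑ k, ((w k - if k = i then s else 0) / (1 - s)) • x k
    have hq : q ∈ convexHull ℝ (Set.range x) := by
      refine (mem_convexHull_range_iff_weights x q).2 ⟨_, fun k => ?_, ?_, rfl⟩
      · apply div_nonneg _ (by linarith)
        split_ifs with hk
        · subst hk; linarith
        · simpa using h0 k
      · rw [← Finset.sum_div, Finset.sum_sub_distrib, h1]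
        simp
        exact (sub_pos.2 hs1).ne'
    refine hF.left_mem_of_mem_openSegment (subset_convexHull _ _ ⟨i, rfl⟩) hq hy
      ⟨s, 1 - s, hs0, by linarith, by ring, ?_⟩
    simp only [q, Finset.smul_sum, smul_smul]
    have : ∀ k, (1 - s) * ((w k - if k = i then s else 0) / (1 - s))
        = w k - if k = i then s else 0 := fun k => by
      have : 1 - s ≠ 0 := by linarith
      field_simp
    simp only [this, sub_smul, Finset.sum_sub_distrib, ite_smul, zero_smul,
      Finset.sum_ite_eq', Finset.mem_univ, if_true]
    abel
  · apply convexHull_min _ hc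
    rintro _ ⟨i, hi, rfl⟩
    exact (hJ i).1 hi

theorem IsExposedIndexSet.le {x : ι → E} {J : Finset ι} {f : E →L[ℝ] ℝ} {c : ℝ}
    (h1 : ∀ i ∈ J, f (x i) = c) (h2 : ∀ i ∉ J, f (x i) < c) (i : ι) : f (x i) ≤ c := by
  by_cases hi : i ∈ J
  · exact (h1 i hi).le
  · exact (h2 i hi).le

theorem le_on_convexHull {x : ι → E} {f : E →L[ℝ] ℝ} {c : ℝ} (h : ∀ i, f (x i) ≤ c) {y : E}
    (hy : y ∈ convexHull ℝ (Set.range x)) : f y ≤ c := by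
  have : convexHull ℝ (Set.range x) ⊆ {y | f y ≤ c} := by
    apply convexHull_min
    · rintro _ ⟨i, rfl⟩; exact h i
    · exact convex_halfSpace_le f.toLinearMap.isLinear c
  exact this hy

theorem IsExposedIndexSet.isExtreme [Fintype ι] {x : ι → E} {J : Finset ι}
    (h : IsExposedIndexSet x J) :
    IsExtreme ℝ (convexHull ℝ (Set.range x)) (convexHull ℝ (x '' J)) := by
  obtain ⟨f, c, h1, h2⟩ := h
  have hle := IsExposedIndexSet.le h1 h2
  have key : ∀ y ∈ convexHull ℝ (Set.range x), f y = c → y ∈ convexHull ℝ (x '' J) := by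
    intro y hy hfy
    obtain ⟨w, h0, hs, rfl⟩ := (mem_convexHull_range_iff_weights x y).1 hy
    refine weights_mem_convexHull_image x J w h0 hs fun i hi => ?_
    have hz : ∑ i, w i * (c - f (x i)) = 0 := by
      simp only [mul_sub, Finset.sum_sub_distrib, ← Finset.sum_mul, hs]
      simp only [map_sum, map_smul, smul_eq_mul] at hfy
      linarith
    have := (Finset.sum_eq_zero_iff_of_nonneg
      (fun i _ => mul_nonneg (h0 i) (sub_nonneg.2 (hle i)))).1 hz i (Finset.mem_univ _)
    rcases mul_eq_zero.1 this with h | h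
    · exact h
    · exact absurd h (sub_pos.2 (h2 i hi)).ne'
  have key2 : ∀ y ∈ convexHull ℝ (x '' J), f y = c := by
    intro y hy
    have : convexHull ℝ (x '' J) ⊆ {y | f y = c} := by
      apply convexHull_min
      · rintro _ ⟨i, hi, rfl⟩; exact h1 i hi
      · exact convex_hyperplane f.toLinearMap.isLinear c
    exact this hy
  refine ⟨convexHull_mono (Set.image_subset_range _ _), ?_⟩
  rintro a ha b hb z hz ⟨s, t, hs, ht, hst, rfl⟩
  apply key a ha
  have hfz := key2 _ hz
  simp only [map_add, map_smul, smul_eq_mul] at hfz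
  have ha' := le_on_convexHull hle ha
  have hb' := le_on_convexHull hle hb
  have h3 : t * f b ≤ t * c := mul_le_mul_of_nonneg_left hb' ht.le
  have h4 : s * c ≤ s * f a := by
    have : s * c + t * c = c := by rw [← add_mul, hst, one_mul]
    linarith
  exact le_antisymm ha' (le_of_mul_le_mul_left h4 hs)

theorem exists_separating_of_notMem_affineSpan [FiniteDimensional ℝ E] {S : Set E} {p : E}
    (hp : p ∉ affineSpan ℝ S) :
    ∃ f : E →L[ℝ] ℝ, ∃ c : ℝ, (∀ s ∈ S, f s = c) ∧ f p = c + 1 := by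
  rcases S.eq_empty_or_nonempty with rfl | ⟨q, hq⟩
  · exact ⟨0, -1, by simp, by simp⟩
  have hq' : q ∈ affineSpan ℝ S := subset_affineSpan ℝ S hq
  have : p - q ∉ (affineSpan ℝ S).direction := by
    intro h
    exact hp ((AffineSubspace.vsub_right_mem_direction_iff_mem hq' p).1 h)
  obtain ⟨f, hf, hker⟩ := Submodule.exists_le_ker_of_notMem this
  let g : E →ₗ[ℝ] ℝ := (f (p - q))⁻¹ • f
  have hg : g (p - q) = 1 := inv_mul_cancel₀ hf
  refine ⟨LinearMap.toContinuousLinearMap g, g q, fun s hs => ?_, ?_⟩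
  · have h1 : s - q ∈ (affineSpan ℝ S).direction :=
      (AffineSubspace.vsub_right_mem_direction_iff_mem hq' s).2 (subset_affineSpan ℝ S hs)
    have h2 : f (s - q) = 0 := hker h1
    have h3 : g (s - q) = 0 := by simp [g, h2]
    rw [map_sub] at h3
    simpa using sub_eq_zero.1 h3
  · rw [map_sub] at hg
    simp only [LinearMap.coe_toContinuousLinearMap']
    linarith

theorem eq_on_affineSpan {S : Set E} {f : E →L[ℝ] ℝ} {c : ℝ} (h : ∀ s ∈ S, f s = c) {y : E}
    (hy : y ∈ affineSpan ℝ S) : f y = c := by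
  by_contra hne
  have hsub : S ⊆ {z | f z = c} := h
  rcases S.eq_empty_or_nonempty with rfl | ⟨q, hq⟩
  · simp [AffineSubspace.span_empty] at hy; exact hy
  let A : AffineSubspace ℝ E := AffineSubspace.mk' q f.toLinearMap.ker
  have hA : affineSpan ℝ S ≤ A := by
    rw [affineSpan_le]
    intro s hs
    simp [A, AffineSubspace.mem_mk', h s hs, h q hq]
  have := hA hy
  simp only [A, AffineSubspace.mem_mk', vsub_eq_sub, LinearMap.mem_ker,
    ContinuousLinearMap.coe_coe, map_sub, h q hq] at this
  exact hne (by linarith)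

variable [FiniteDimensional ℝ E]

theorem InGeneralPosition.affineIndependent {x : ι → E} (hx : InGeneralPosition x)
    (K : Finset ι) (hK : K.card ≤ finrank ℝ E + 1) :
    AffineIndependent ℝ (fun i : K => x i) := by
  classical
  rw [affineIndependent_iff]
  rintro s w hw0 hw1 ⟨i, hi⟩ his
  have hcard : (K.erase i).card ≤ finrank ℝ E := by
    rw [Finset.card_erase_of_mem hi]; omega
  obtain ⟨f, c, hf1, hf2⟩ := exists_separating_of_notMem_affineSpan
    (hx i (K.erase i) (Finset.notMem_erase i K) hcard)
  have hval : ∀ k ∈ s, w k * f (x k) = w k * c + if k = ⟨i, hi⟩ then w k else 0 := by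
    rintro ⟨k, hk⟩ -
    split_ifs with h
    · have : k = i := congrArg Subtype.val h
      subst this
      rw [hf2]; ring
    · rw [hf1 (x k) ⟨k, ?_, rfl⟩, add_zero]
      simp only [Finset.coe_erase, Set.mem_sdiff, Finset.mem_coe, Set.mem_singleton_iff]
      exact ⟨hk, fun e => h (Subtype.ext e)⟩
  have := congrArg f hw1
  rw [map_sum, map_zero] at this
  simp only [map_smul, smul_eq_mul] at this
  rw [Finset.sum_congr rfl hval, Finset.sum_add_distrib, ← Finset.sum_mul, hw0] at this
  simpa [his] using this

theorem InGeneralPosition.affineSpan_eq_top {x : ι → E} (hx : InGeneralPosition x)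
    (K : Finset ι) (hK : finrank ℝ E + 1 ≤ K.card) : affineSpan ℝ (x '' K) = ⊤ := by
  obtain ⟨T, hT, hcard⟩ := Finset.exists_subset_card_eq hK
  have hi := hx.affineIndependent T hcard.le
  have := (hi.affineSpan_eq_top_iff_card_eq_finrank_add_one).2 (by simpa using hcard)
  rw [eq_top_iff, ← this]
  apply affineSpan_mono
  rintro _ ⟨⟨k, hk⟩, rfl⟩
  exact ⟨k, hT hk, rfl⟩

theorem InGeneralPosition.card_le_of_isExposedIndexSet [Fintype ι] {x : ι → E}
    (hx : InGeneralPosition x) {K : Finset ι} (hK : IsExposedIndexSet x K) {l : ι}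
    (hl : l ∉ K) : K.card ≤ finrank ℝ E := by
  by_contra hcard
  obtain ⟨f, c, h1, h2⟩ := hK
  have htop := hx.affineSpan_eq_top K (by omega)
  have : f (x l) = c := by
    apply eq_on_affineSpan (S := x '' K)
    · rintro _ ⟨i, hi, rfl⟩; exact h1 i hi
    · rw [htop]; trivial
  exact absurd this (h2 l hl).ne

theorem IsExposedIndexSet.erase [Fintype ι] [DecidableEq ι] {x : ι → E}
    (hx : InGeneralPosition x) {K : Finset ι} (hK : IsExposedIndexSet x K)
    (hcard : K.card ≤ finrank ℝ E + 1) {l : ι} (hl : l ∈ K) :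
    IsExposedIndexSet x (K.erase l) := by
  have hnot : x l ∉ affineSpan ℝ (x '' (K.erase l : Finset ι)) :=
    hx l _ (Finset.notMem_erase l K) (by rw [Finset.card_erase_of_mem hl]; omega)
  obtain ⟨g, b, hg1, hg2⟩ := exists_separating_of_notMem_affineSpan hnot
  obtain ⟨f, c, h1, h2⟩ := hK
  have hev : ∀ᶠ ε in nhdsWithin (0 : ℝ) (Set.Ioi 0), ∀ i, i ∉ K →
      f (x i) - ε * (g (x i) - b) < c := by
    rw [eventually_all]
    intro i
    by_cases hi : i ∈ K
    · exact Eventually.of_forall fun _ h => absurd hi h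
    have ht : Tendsto (fun ε : ℝ => f (x i) - ε * (g (x i) - b)) (nhdsWithin 0 (Set.Ioi 0))
        (nhds (f (x i) - 0 * (g (x i) - b))) := by
      apply Tendsto.mono_left _ nhdsWithin_le_nhds
      apply Continuous.tendsto
      fun_prop
    have := ht.eventually_lt_const (u := c) (by simpa using h2 i hi)
    exact this.mono fun _ h _ => h
  obtain ⟨ε, hε, hpos⟩ := (hev.and self_mem_nhdsWithin).exists
  have hpos : 0 < ε := hpos
  refine ⟨f - ε • g, c - ε * b, fun i hi => ?_, fun i hi => ?_⟩
  · have := hg1 (x i) ⟨i, hi, rfl⟩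
    simp [h1 i (Finset.mem_of_mem_erase hi), this]
  · simp only [sub_apply, smul_apply, smul_eq_mul]
    by_cases hiK : i ∈ K
    · have : i = l := by
        by_contra hne
        exact hi (Finset.mem_erase.2 ⟨hne, hiK⟩)
      subst this
      rw [h1 i hiK, hg2]
      nlinarith
    · have := hε i hiK
      linarith

theorem IsExposedIndexSet.subset [Fintype ι] {x : ι → E}
    (hx : InGeneralPosition x) {K : Finset ι} (hK : IsExposedIndexSet x K)
    (hcard : K.card ≤ finrank ℝ E + 1) {J : Finset ι} (hJ : J ⊆ K) :
    IsExposedIndexSet x J := by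
  classical
  induction hk : (K \ J).card generalizing K with
  | zero =>
    have : K ⊆ J := by simpa [Finset.sdiff_eq_empty_iff_subset] using hk
    rwa [Finset.Subset.antisymm hJ this]
  | succ r ih =>
    have hne : (K \ J).Nonempty := by
      rw [← Finset.card_pos]; omega
    obtain ⟨l, hl⟩ := hne
    rw [Finset.mem_sdiff] at hl
    refine ih (hK.erase hx hcard hl.1) ?_ ?_ ?_
    · exact (Finset.card_le_card (Finset.erase_subset _ _)).trans hcard
    · intro i hi
      exact Finset.mem_erase.2 ⟨fun h => hl.2 (h ▸ hi), hJ hi⟩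
    · have : K.erase l \ J = (K \ J).erase l := by
        ext i; simp only [Finset.mem_sdiff, Finset.mem_erase]; tauto
      rw [this, Finset.card_erase_of_mem (Finset.mem_sdiff.2 hl), hk]
      rfl

theorem IsExposedIndexSet.exists_ssuperset [Fintype ι] {x : ι → E}
    (hx : InGeneralPosition x) (hn : finrank ℝ E + 1 ≤ Fintype.card ι) {K : Finset ι}
    (hK : IsExposedIndexSet x K) (hcard : K.card < finrank ℝ E) :
    ∃ K', K ⊂ K' ∧ IsExposedIndexSet x K' ∧ K'.card ≤ finrank ℝ E := by
  classical
  obtain ⟨f, c, h1, h2⟩ := hK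
  obtain ⟨l, hl⟩ : ∃ l, l ∉ K := by
    by_contra! h
    have : K = Finset.univ := Finset.eq_univ_of_forall h
    rw [this, Finset.card_univ] at hcard; omega
  have hcl : (insert l K).card = K.card + 1 := Finset.card_insert_of_notMem hl
  obtain ⟨l', hl'⟩ : ∃ l', l' ∉ insert l K := by
    by_contra! h
    have : insert l K = Finset.univ := Finset.eq_univ_of_forall h
    rw [this, Finset.card_univ] at hcl; omega
  obtain ⟨g, b, hg1, hg2⟩ := exists_separating_of_notMem_affineSpan
    (hx l' (insert l K) hl' (by omega))
  have hgK : ∀ i ∈ insert l K, g (x i) = b := fun i hi => hg1 _ ⟨i, hi, rfl⟩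
  let S : Finset ι := Finset.univ.filter fun i => 0 < g (x i) - b
  have hS : S.Nonempty := ⟨l', by simp [S, hg2]⟩
  obtain ⟨i₀, hi₀, hmin⟩ := S.exists_min_image (fun i => (c - f (x i)) / (g (x i) - b)) hS
  have hi₀' : 0 < g (x i₀) - b := (Finset.mem_filter.1 hi₀).2
  set lam := (c - f (x i₀)) / (g (x i₀) - b) with hlam
  have hle := IsExposedIndexSet.le h1 h2
  have hlam0 : 0 ≤ lam := div_nonneg (sub_nonneg.2 (hle i₀)) hi₀'.le
  have hall : ∀ i, (f + lam • g) (x i) ≤ c + lam * b := by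
    intro i
    simp only [add_apply, smul_apply, smul_eq_mul]
    by_cases hi : 0 < g (x i) - b
    · have := hmin i (Finset.mem_filter.2 ⟨Finset.mem_univ _, hi⟩)
      rw [le_div_iff₀ hi] at this
      linarith
    · have := hle i
      nlinarith
  let K' : Finset ι := Finset.univ.filter fun i => (f + lam • g) (x i) = c + lam * b
  have hlK' : l ∉ K' := by
    simp only [K', Finset.mem_filter, Finset.mem_univ, true_and, add_apply,
      smul_apply, smul_eq_mul, hgK l (Finset.mem_insert_self _ _)]
    have := h2 l hl
    intro h; linarith
  have hK' : IsExposedIndexSet x K' := by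
    refine ⟨f + lam • g, c + lam * b, fun i hi => (Finset.mem_filter.1 hi).2, fun i hi => ?_⟩
    refine lt_of_le_of_ne (hall i) fun h => hi ?_
    exact Finset.mem_filter.2 ⟨Finset.mem_univ _, h⟩
  refine ⟨K', ⟨fun i hi => ?_, fun h => ?_⟩, hK', hx.card_le_of_isExposedIndexSet hK' hlK'⟩
  · simp [K', h1 i hi, hgK i (Finset.mem_insert_of_mem hi)]
  · have : i₀ ∈ K' := by
      have : lam * (g (x i₀) - b) = c - f (x i₀) := by rw [hlam]; field_simp
      simp only [K', Finset.mem_filter, Finset.mem_univ, true_and, add_apply,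
        smul_apply, smul_eq_mul]
      linarith
    have := hgK i₀ (Finset.mem_insert_of_mem (h this))
    linarith

theorem IsExposedIndexSet.exists_superset_card_eq [Fintype ι] {x : ι → E}
    (hx : InGeneralPosition x) (hn : finrank ℝ E + 1 ≤ Fintype.card ι) {K : Finset ι}
    (hK : IsExposedIndexSet x K) (hcard : K.card ≤ finrank ℝ E) {r : ℕ} (hr : K.card ≤ r)
    (hr' : r ≤ finrank ℝ E) :
    ∃ J, K ⊆ J ∧ IsExposedIndexSet x J ∧ J.card = r := by
  obtain ⟨L, hKL, hL, hLc⟩ : ∃ L, K ⊆ L ∧ IsExposedIndexSet x L ∧ L.card = finrank ℝ E := by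
    clear hr hr'
    induction hk : finrank ℝ E - K.card using Nat.strong_induction_on generalizing K with
    | _ k ih =>
      rcases hcard.lt_or_eq with hlt | heq
      · obtain ⟨K', hss, hK', hc'⟩ := hK.exists_ssuperset hx hn hlt
        have := Finset.card_lt_card hss
        obtain ⟨L, h1, h2⟩ := ih _ (by omega) hK' hc' rfl
        exact ⟨L, hss.1.trans h1, h2⟩
      · exact ⟨K, Finset.Subset.refl _, hK, heq⟩
  obtain ⟨J, h1, h2, h3⟩ := Finset.exists_subsuperset_card_eq hKL hr (by omega)
  exact ⟨J, h1, hL.subset hx (by omega) h2, h3⟩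

theorem InGeneralPosition.isExposedIndexSet_of_isExtreme [Fintype ι] {x : ι → E}
    (hx : InGeneralPosition x) (hn : finrank ℝ E + 1 ≤ Fintype.card ι) {J : Finset ι}
    (hJ : J.Nonempty) (hcard : J.card ≤ finrank ℝ E)
    (h : IsExtreme ℝ (convexHull ℝ (Set.range x)) (convexHull ℝ (x '' J))) :
    IsExposedIndexSet x J := by
  classical
  set P := convexHull ℝ (Set.range x) with hP
  obtain ⟨l, hl⟩ : ∃ l, l ∉ J := by
    by_contra! h
    have : J = Finset.univ := Finset.eq_univ_of_forall h
    rw [this, Finset.card_univ] at hcard; omega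
  have hJc : (0 : ℝ) < J.card := by exact_mod_cast hJ.card_pos
  let y : E := ∑ i ∈ J, (J.card : ℝ)⁻¹ • x i
  have hyJ : y ∈ convexHull ℝ (x '' J) := by
    have := J.centerMass_mem_convexHull (R := ℝ) (s := x '' J) (z := x)
      (w := fun _ => (J.card : ℝ)⁻¹) (fun i _ => by positivity)
      (by simp; positivity) (fun i hi => ⟨i, hi, rfl⟩)
    rwa [Finset.centerMass_eq_of_sum_1 _ _ (by simp [hJc.ne'])] at this
  have htop : affineSpan ℝ (Set.range x) = ⊤ := by
    have := hx.affineSpan_eq_top Finset.univ (by simpa using hn)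
    simpa using this
  have hint : (interior P).Nonempty := interior_convexHull_nonempty_iff_affineSpan_eq_top.2 htop
  have hPc : Convex ℝ P := convex_convexHull ℝ _
  have hy : y ∉ interior P := by
    intro hyi
    have hlP : x l ∈ P := subset_convexHull _ _ ⟨l, rfl⟩
    have hcont : Continuous fun t : ℝ => y + t • (y - x l) := by fun_prop
    have hev : ∀ᶠ t in nhdsWithin (0 : ℝ) (Set.Ioi 0), y + t • (y - x l) ∈ interior P := by
      have ht := (hcont.tendsto 0).mono_left (nhdsWithin_le_nhds (s := Set.Ioi 0))
      apply ht.eventually_mem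
      apply isOpen_interior.mem_nhds
      simpa using hyi
    obtain ⟨t, ht, htpos⟩ := (hev.and self_mem_nhdsWithin).exists
    have htpos : 0 < t := htpos
    have hmem : x l ∈ convexHull ℝ (x '' J) := by
      refine h.left_mem_of_mem_openSegment hlP (interior_subset ht) hyJ
        ⟨t / (1 + t), 1 / (1 + t), by positivity, by positivity, by field_simp; ring, ?_⟩
      have e1 : y = ((1 + t) / (1 + t)) • y := by rw [div_self (by positivity), one_smul]
      conv_rhs => rw [e1]
      module
    exact hx l J hl hcard (convexHull_subset_affineSpan _ hmem)
  obtain ⟨f, hf⟩ := geometric_hahn_banach_open_point hPc.interior isOpen_interior hy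
  have hle : ∀ p ∈ P, f p ≤ f y := by
    intro p hp
    have hp' : p ∈ closure (interior P) := by
      rw [hPc.closure_interior_eq_closure_of_nonempty_interior hint]
      exact subset_closure hp
    have hcl : IsClosed {p | f p ≤ f y} := isClosed_le f.continuous continuous_const
    exact closure_minimal (fun a ha => (hf a ha).le) hcl hp'
  have hxle : ∀ i, f (x i) ≤ f y := fun i => hle _ (subset_convexHull _ _ ⟨i, rfl⟩)
  let K : Finset ι := Finset.univ.filter fun i => f (x i) = f y
  have hK : IsExposedIndexSet x K := by
    refine ⟨f, f y, fun i hi => (Finset.mem_filter.1 hi).2, fun i hi => ?_⟩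
    refine lt_of_le_of_ne (hxle i) fun h => hi ?_
    exact Finset.mem_filter.2 ⟨Finset.mem_univ _, h⟩
  have hJK : J ⊆ K := by
    intro i hi
    have hsum : ∑ i ∈ J, (f y - f (x i)) = 0 := by
      have : f y = (J.card : ℝ)⁻¹ * ∑ i ∈ J, f (x i) := by
        simp only [y, map_sum, map_smul, smul_eq_mul, Finset.mul_sum]
      rw [Finset.sum_sub_distrib, Finset.sum_const, nsmul_eq_mul]
      nth_rewrite 1 [this]
      field_simp
      ring
    have := (Finset.sum_eq_zero_iff_of_nonneg fun i _ => sub_nonneg.2 (hxle i)).1 hsum i hi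
    simp only [K, Finset.mem_filter, Finset.mem_univ, true_and]
    linarith
  obtain ⟨k, hk⟩ : ∃ k, k ∉ K := by
    by_contra! hall
    obtain ⟨p, hp⟩ := hint
    have : f p = f y := by
      apply eq_on_affineSpan (S := Set.range x)
      · rintro _ ⟨i, rfl⟩
        exact (Finset.mem_filter.1 (hall i)).2
      · rw [htop]; trivial
    exact absurd this (hf p hp).ne
  have := hx.card_le_of_isExposedIndexSet hK hk
  exact hK.subset hx (by omega) hJK

open Classical in
/-- In general position the `j`-faces are counted by exposed sets of `j + 1` points. -/
theorem InGeneralPosition.faceCount_eq [Fintype ι] {x : ι → E}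
    (hx : InGeneralPosition x) (hn : finrank ℝ E + 1 ≤ Fintype.card ι) {j : ℕ}
    (hj : j < finrank ℝ E) :
    faceCount (convexHull ℝ (Set.range x)) j =
      ((Finset.powersetCard (j + 1) Finset.univ).filter fun J => IsExposedIndexSet x J).card := by
  have hspan : ∀ J : Finset ι, J.card ≤ finrank ℝ E + 1 → ∀ r, J.card = r + 1 →
      finrank ℝ (vectorSpan ℝ (convexHull ℝ (x '' J))) = r := by
    intro J hJ r hr
    have h := (hx.affineIndependent J hJ).finrank_vectorSpan (n := r) (by simpa using hr)
    have hrange : Set.range (fun i : J => x i) = x '' J := by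
      ext z; simp
    rw [hrange] at h
    rw [← direction_affineSpan, affineSpan_convexHull, direction_affineSpan]
    exact h
  unfold faceCount
  rw [← Fintype.card_coe, ← Nat.card_eq_fintype_card]
  symm
  have hmem : ∀ J : Finset ι,
      J ∈ (Finset.powersetCard (j + 1) Finset.univ).filter (fun J => IsExposedIndexSet x J) ↔
        J.card = j + 1 ∧ IsExposedIndexSet x J := by
    intro J; simp [Finset.mem_powersetCard]
  refine Nat.card_congr (Equiv.ofBijective (fun J => ⟨convexHull ℝ (x '' J.1), ?_⟩) ⟨?_, ?_⟩)
  · obtain ⟨J, hJ⟩ := J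
    rw [hmem] at hJ
    have hne : J.Nonempty := by rw [← Finset.card_pos]; omega
    exact ⟨by simpa using hne, convex_convexHull ℝ _, hJ.2.isExtreme,
      hspan J (by omega) j hJ.1⟩
  · rintro ⟨J, hJ⟩ ⟨J', hJ'⟩ heq
    rw [hmem] at hJ hJ'
    have heq' : convexHull ℝ (x '' J) = convexHull ℝ (x '' J') := congrArg Subtype.val heq
    have hsub : J ⊆ J' := by
      intro i hi
      by_contra hn'
      have h1 : x i ∈ convexHull ℝ (x '' J') := heq' ▸ subset_convexHull ℝ _ ⟨i, hi, rfl⟩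
      exact hx i J' hn' (by omega) (convexHull_subset_affineSpan _ h1)
    exact Subtype.ext (Finset.eq_of_subset_of_card_le hsub (hJ'.1.trans hJ.1.symm).le)
  · rintro ⟨F, hne, hc, hext, hfr⟩
    let J : Finset ι := Finset.univ.filter fun i => x i ∈ F
    have hF := hext.eq_convexHull_image hc J (by simp [J])
    have hJne : J.Nonempty := by
      rw [hF] at hne
      simpa using hne
    have hJle : J.card ≤ finrank ℝ E := by
      by_contra hgt
      have htop := hx.affineSpan_eq_top J (by omega)
      rw [hF, ← direction_affineSpan, affineSpan_convexHull, htop, AffineSubspace.direction_top,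
        finrank_top] at hfr
      omega
    have hJc : J.card = j + 1 := by
      have := hspan J (by omega) (J.card - 1) (by have := hJne.card_pos; omega)
      rw [← hF, hfr] at this
      have := hJne.card_pos
      omega
    refine ⟨⟨J, (hmem J).2 ⟨hJc, ?_⟩⟩, Subtype.ext hF.symm⟩
    exact hx.isExposedIndexSet_of_isExtreme hn hJne hJle (hF ▸ hext)

open Classical in
/-- Every vertex lies in a `j`-face. -/
theorem InGeneralPosition.card_vertices_le [Fintype ι] {x : ι → E}
    (hx : InGeneralPosition x) (hn : finrank ℝ E + 1 ≤ Fintype.card ι) {j : ℕ}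
    (hj : j < finrank ℝ E) :
    (Finset.univ.filter fun i => IsExposedIndexSet x {i}).card ≤
      (j + 1) * faceCount (convexHull ℝ (Set.range x)) j := by
  rw [hx.faceCount_eq hn hj, mul_comm]
  set S := (Finset.powersetCard (j + 1) Finset.univ).filter fun J => IsExposedIndexSet x J
  have hsub : (Finset.univ.filter fun i => IsExposedIndexSet x {i}) ⊆ S.biUnion id := by
    intro i hi
    have hi' : IsExposedIndexSet x {i} := (Finset.mem_filter.1 hi).2
    obtain ⟨J, h1, h2, h3⟩ := hi'.exists_superset_card_eq hx hn
      (by rw [Finset.card_singleton]; omega) (r := j + 1) (by simp) (by omega)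
    rw [Finset.mem_biUnion]
    exact ⟨J, by simp [S, Finset.mem_powersetCard, h2, h3], h1 (Finset.mem_singleton_self i)⟩
  refine (Finset.card_le_card hsub).trans (Finset.card_biUnion_le_card_mul _ _ _ ?_)
  intro J hJ
  have := (Finset.mem_filter.1 hJ).1
  exact (Finset.mem_powersetCard.1 this).2.le

end Polytope

section Measurability

open Module

theorem measurableSet_exists_of_isClosed {X Y : Type*} [TopologicalSpace X] [MeasurableSpace X]
    [BorelSpace X] [TopologicalSpace Y] [SigmaCompactSpace Y] {S : Set (X × Y)}
    (hS : IsClosed S) : MeasurableSet {x | ∃ y, (x, y) ∈ S} := by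
  have : {x | ∃ y, (x, y) ∈ S} =
      ⋃ k : ℕ, Prod.fst '' ((fun z : X × compactCovering Y k => (z.1, (z.2 : Y))) ⁻¹' S) := by
    ext x
    simp only [Set.mem_ofPred_eq, Set.mem_iUnion, Set.mem_image, Set.mem_preimage]
    constructor
    · rintro ⟨y, hy⟩
      obtain ⟨k, hk⟩ := exists_mem_compactCovering y
      exact ⟨k, (x, ⟨y, hk⟩), hy, rfl⟩
    · rintro ⟨k, ⟨x', y⟩, h, rfl⟩
      exact ⟨y, h⟩
  rw [this]
  refine MeasurableSet.iUnion fun k => IsClosed.measurableSet ?_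
  have : CompactSpace (compactCovering Y k) := isCompact_iff_compactSpace.1
    (isCompact_compactCovering Y k)
  exact isClosedMap_fst_of_compactSpace _ (hS.preimage (by fun_prop))

theorem affineSpan_image_ne_top {ι E : Type*} [NormedAddCommGroup E] [NormedSpace ℝ E]
    [FiniteDimensional ℝ E] [Nontrivial E] (y : ι → E) (J : Finset ι)
    (hJ : J.card ≤ finrank ℝ E) : affineSpan ℝ (y '' J) ≠ ⊤ := by
  classical
  intro h
  rcases J.eq_empty_or_nonempty with rfl | hne
  · simp only [Finset.coe_empty, Set.image_empty, AffineSubspace.span_empty] at h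
    exact AffineSubspace.bot_ne_top ℝ E E h
  · have h1 := finrank_vectorSpan_image_finset_le ℝ y J (n := J.card - 1)
      (by have := hne.card_pos; omega)
    rw [← direction_affineSpan, Finset.coe_image, h, AffineSubspace.direction_top,
      finrank_top] at h1
    have := hne.card_pos
    omega

variable {E : Type*} [NormedAddCommGroup E] [NormedSpace ℝ E] [FiniteDimensional ℝ E]
  [MeasurableSpace E] [BorelSpace E]

theorem measurableSet_isExposedIndexSet {n : ℕ} (J : Finset (Fin n)) :
    MeasurableSet {x : Fin n → E | IsExposedIndexSet x J} := by
  have : ProperSpace (E →L[ℝ] ℝ) := FiniteDimensional.proper ℝ _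
  have : ProperSpace E := FiniteDimensional.proper ℝ E
  let S : Set ((Fin n → E) × ((E →L[ℝ] ℝ) × ℝ)) :=
    {z | (∀ i ∈ J, z.2.1 (z.1 i) = z.2.2) ∧ ∀ i ∉ J, z.2.1 (z.1 i) ≤ z.2.2 - 1}
  have hS : IsClosed S := by
    simp only [S, Set.ofPred_and, Set.ofPred_forall]
    refine IsClosed.inter ?_ ?_
    · exact isClosed_iInter fun i => isClosed_iInter fun _ =>
        isClosed_eq (by fun_prop) (by fun_prop)
    · exact isClosed_iInter fun i => isClosed_iInter fun _ =>
        isClosed_le (by fun_prop) (by fun_prop)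
  convert measurableSet_exists_of_isClosed hS using 1
  ext x
  constructor
  · rintro ⟨f, c, h1, h2⟩
    obtain ⟨δ, hδ, hδ'⟩ : ∃ δ > 0, ∀ i ∉ J, f (x i) ≤ c - δ := by
      have hev : ∀ᶠ δ in nhdsWithin (0 : ℝ) (Set.Ioi 0), ∀ i, i ∉ J → f (x i) ≤ c - δ := by
        rw [eventually_all]
        intro i
        by_cases hi : i ∈ J
        · exact Eventually.of_forall fun _ h => absurd hi h
        have : Set.Ioo 0 (c - f (x i)) ∈ nhdsWithin (0 : ℝ) (Set.Ioi 0) :=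
          Ioo_mem_nhdsGT (sub_pos.2 (h2 i hi))
        filter_upwards [this] with δ hδ _
        linarith [hδ.2]
      obtain ⟨δ, h, hpos⟩ := (hev.and self_mem_nhdsWithin).exists
      exact ⟨δ, hpos, h⟩
    refine ⟨(δ⁻¹ • f, δ⁻¹ * c), fun i hi => ?_, fun i hi => ?_⟩
    · simp [h1 i hi]
    · have := hδ' i hi
      simp only [smul_apply, smul_eq_mul]
      calc δ⁻¹ * f (x i) ≤ δ⁻¹ * (c - δ) := by gcongr
        _ = _ := by field_simp
  · rintro ⟨⟨f, c⟩, h1, h2⟩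
    exact ⟨f, c, h1, fun i hi => (h2 i hi).trans_lt (by simp)⟩

theorem measurableSet_mem_affineSpan {n : ℕ} (J : Finset (Fin n)) :
    MeasurableSet {z : E × (Fin n → E) | z.1 ∈ affineSpan ℝ (z.2 '' J)} := by
  have : ProperSpace E := FiniteDimensional.proper ℝ E
  let S : Set ((E × (Fin n → E)) × (Fin n → ℝ)) :=
    {z | ∑ i ∈ J, z.2 i = 1 ∧ ∑ i ∈ J, z.2 i • z.1.2 i = z.1.1}
  have hS : IsClosed S :=
    (isClosed_eq (by fun_prop) (by fun_prop)).inter (isClosed_eq (by fun_prop) (by fun_prop))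
  convert measurableSet_exists_of_isClosed hS using 1
  ext ⟨p, y⟩
  constructor
  · intro h
    obtain ⟨s, w, hs, hw, heq⟩ := eq_affineCombination_of_mem_affineSpan_image h
    have hs' : s ⊆ J := by exact_mod_cast hs
    rw [Finset.affineCombination_eq_linear_combination _ _ _ hw] at heq
    refine ⟨fun i => if i ∈ s then w i else 0, ?_, ?_⟩
    · simpa [Finset.sum_ite_mem, Finset.inter_eq_right.2 hs'] using hw
    · simpa [Finset.sum_ite_mem, Finset.inter_eq_right.2 hs', ite_smul] using heq.symm
  · rintro ⟨w, hw, heq⟩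
    have := affineCombination_mem_affineSpan_image (k := ℝ) (s := J) hw (s' := J)
      (fun i hi h => absurd hi h) y
    rw [Finset.affineCombination_eq_linear_combination _ _ _ hw] at this
    have h2 : ∑ i ∈ J, w i • y i = p := heq
    rw [h2] at this
    exact this

theorem ae_inGeneralPosition [Nontrivial E] (μ : Measure E) [IsProbabilityMeasure μ]
    (hμ : ∀ A : AffineSubspace ℝ E, A ≠ ⊤ → μ A = 0) (n : ℕ) :
    ∀ᵐ x ∂Measure.pi (fun _ : Fin n => μ), InGeneralPosition x := by
  have : ProperSpace E := FiniteDimensional.proper ℝ E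
  unfold InGeneralPosition
  rw [ae_all_iff]
  intro i
  rw [ae_all_iff]
  intro J
  by_cases hi : i ∈ J
  · exact ae_of_all _ fun x h => absurd hi h
  by_cases hJ : J.card ≤ finrank ℝ E
  swap
  · exact ae_of_all _ fun x _ h => absurd h hJ
  cases n with
  | zero => exact i.elim0
  | succ n =>
    have hmp := measurePreserving_piFinSuccAbove (fun _ : Fin (n + 1) => μ) i
    let J' : Finset (Fin n) := J.preimage i.succAbove Fin.succAbove_right_injective.injOn
    have hJ' : J'.card ≤ finrank ℝ E := by
      refine le_trans ?_ hJ
      refine Finset.card_le_card_of_injOn i.succAbove (fun k hk => ?_)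
        Fin.succAbove_right_injective.injOn
      simpa [J'] using hk
    let S := {z : E × (Fin n → E) | z.1 ∈ affineSpan ℝ (z.2 '' J')}
    have hS : MeasurableSet S := measurableSet_mem_affineSpan J'
    have hnull : (μ.prod (Measure.pi fun _ : Fin n => μ)) S = 0 := by
      rw [Measure.prod_apply_symm hS, lintegral_eq_zero_iff]
      · refine ae_of_all _ fun y => ?_
        exact hμ _ (affineSpan_image_ne_top y J' hJ')
      · exact measurable_measure_prodMk_right hS
    have hpre := hmp.quasiMeasurePreserving.preimage_null hnull
    filter_upwards [compl_mem_ae_iff.2 hpre] with x hx _ _ hmem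
    apply hx
    simp only [Set.mem_preimage, S, Set.mem_ofPred_eq]
    have himg : (MeasurableEquiv.piFinSuccAbove (fun _ => E) i x).2 '' (J' : Set (Fin n)) =
        x '' (J : Set (Fin (n + 1))) := ?_
    · rw [himg]
      exact hmem
    ext p
    constructor
    · rintro ⟨k, hk, rfl⟩
      exact ⟨i.succAbove k, by simpa [J'] using hk, rfl⟩
    · rintro ⟨k, hk, rfl⟩
      have hne : k ≠ i := fun h => hi (h ▸ hk)
      obtain ⟨l, rfl⟩ := Fin.exists_succAbove_eq hne
      exact ⟨l, by simpa [J'] using hk, rfl⟩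

open Classical in
theorem aemeasurable_faceCount {n : ℕ} (ν : Measure (Fin n → E))
    (hν : ∀ᵐ x ∂ν, InGeneralPosition x) (hn : finrank ℝ E + 1 ≤ n) {j : ℕ}
    (hj : j < finrank ℝ E) :
    AEMeasurable (fun x : Fin n → E => (faceCount (convexHull ℝ (Set.range x)) j : ℝ)) ν := by
  refine ⟨fun x => ∑ J ∈ Finset.powersetCard (j + 1) Finset.univ,
    Set.indicator {x : Fin n → E | IsExposedIndexSet x J} (fun _ => (1 : ℝ)) x, ?_, ?_⟩
  · exact Finset.measurable_sum _ fun J _ =>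
      measurable_const.indicator (measurableSet_isExposedIndexSet J)
  · filter_upwards [hν] with x hx
    rw [hx.faceCount_eq (by simpa using hn) hj, Finset.card_filter]
    push_cast
    refine Finset.sum_congr rfl fun J _ => ?_
    simp [Set.indicator_apply]

end Measurability

theorem measure_pi_le_of_le {ι : Type*} [Fintype ι] {α : ι → Type*} [∀ i, MeasurableSpace (α i)]
    (μ ν : ∀ i, Measure (α i)) [∀ i, SigmaFinite (μ i)] [∀ i, SigmaFinite (ν i)]
    {C : ENNReal} (hC : C ≠ 0) (hC' : C ≠ ⊤) (h : ∀ i s, μ i s ≤ C * ν i s) :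
    Measure.pi μ ≤ C ^ Fintype.card ι • Measure.pi ν := by
  refine Measure.le_iff.2 fun s hs => ?_
  set c := C ^ Fintype.card ι with hc
  have hc0 : c ≠ 0 := pow_ne_zero _ hC
  have hct : c ≠ ⊤ := ENNReal.pow_ne_top hC'
  have key : c⁻¹ • (Measure.pi μ).toOuterMeasure ≤
      OuterMeasure.pi fun i => (ν i).toOuterMeasure := by
    refine OuterMeasure.le_pi.2 fun t _ => ?_
    simp only [smul_apply, Measure.coe_toOuterMeasure, smul_eq_mul]
    rw [Measure.pi_pi, ← ENNReal.div_eq_inv_mul]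
    refine ENNReal.div_le_of_le_mul ?_
    calc ∏ i, μ i (t i) ≤ ∏ i, C * ν i (t i) := Finset.prod_le_prod' fun i _ => h i _
      _ = _ := by rw [Finset.prod_mul_distrib, Finset.prod_const, mul_comm]; rfl
  have h2 := key s
  simp only [smul_apply, Measure.coe_toOuterMeasure, smul_eq_mul] at h2
  rw [Measure.smul_apply, smul_eq_mul]
  have h3 : Measure.pi ν s = OuterMeasure.pi (fun i => (ν i).toOuterMeasure) s := by
    rw [Measure.pi, toMeasure_apply _ _ hs]
  rw [h3]
  calc Measure.pi μ s = c * (c⁻¹ * Measure.pi μ s) := by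
        rw [← mul_assoc, ENNReal.mul_inv_cancel hc0 hct, one_mul]
    _ ≤ _ := by gcongr

section BetaMeasure

open Module

theorem betaConst_pos {β : ℝ} (hβ : 0 ≤ β) (k : ℕ) : 0 < betaConst β k := by
  unfold betaConst
  have h1 : 0 < Real.Gamma ((k : ℝ) / 2 + β + 1) := Real.Gamma_pos_of_pos (by positivity)
  have h2 : 0 < Real.Gamma (β + 1) := Real.Gamma_pos_of_pos (by positivity)
  positivity

theorem betaDensity_nonneg {β : ℝ} (hβ : 0 ≤ β) (k : ℕ) (y : EuclideanSpace ℝ (Fin k)) :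
    0 ≤ betaDensity β k y := by
  unfold betaDensity
  split_ifs with h
  · have : 0 ≤ 1 - ‖y‖ ^ 2 := by nlinarith [norm_nonneg y]
    have := (betaConst_pos hβ k).le
    positivity
  · exact le_rfl

theorem integral_betaDensity {β : ℝ} (hβ : 0 ≤ β) {k : ℕ} (hk : 1 ≤ k) :
    ∫ y, betaDensity β k y = 1 := by
  have hk' : (0 : ℝ) < k := by exact_mod_cast hk
  have : Nonempty (Fin k) := ⟨⟨0, hk⟩⟩
  have : Nontrivial (EuclideanSpace ℝ (Fin k)) := by
    apply Module.nontrivial_of_finrank_pos (R := ℝ)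
    simp only [finrank_euclideanSpace, Fintype.card_fin]
    omega
  set q := ProbabilityTheory.betaPDFReal ((k : ℝ) / 2) (β + 1) with hq
  set B := ProbabilityTheory.beta ((k : ℝ) / 2) (β + 1) with hB
  have hBpos : 0 < B := ProbabilityTheory.beta_pos (by positivity) (by positivity)
  have hqnn : ∀ t, 0 ≤ q t := by
    intro t
    by_cases h : 0 < t ∧ t < 1
    · exact (ProbabilityTheory.betaPDFReal_pos h.1 h.2 (by positivity) (by positivity)).le
    · rw [hq, ProbabilityTheory.betaPDFReal, if_neg h]
  have hq1 : ∫ t in Set.Ioi (0 : ℝ), q t = 1 := by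
    rw [setIntegral_eq_integral_of_forall_compl_eq_zero (fun t ht => ?_)]
    · rw [integral_eq_lintegral_of_nonneg_ae (ae_of_all _ hqnn)
        (ProbabilityTheory.stronglyMeasurable_betaPDFReal _ _).aestronglyMeasurable]
      have h := ProbabilityTheory.lintegral_betaPDF_eq_one (α := (k : ℝ) / 2) (β := β + 1)
        (by positivity) (by positivity)
      simp only [ProbabilityTheory.betaPDF] at h
      rw [h]; simp
    · rw [hq, ProbabilityTheory.betaPDFReal, if_neg (fun h => ht h.1)]
  rw [← integral_comp_rpow_Ioi_of_pos (g := q) (p := 2) two_pos] at hq1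
  have h := integral_fun_norm_addHaar (volume : Measure (EuclideanSpace ℝ (Fin k)))
    (fun r => if r ≤ 1 then betaConst β k * (1 - r ^ 2) ^ β else 0)
  have h0 : ∫ y, betaDensity β k y = ∫ y : EuclideanSpace ℝ (Fin k),
      (if ‖y‖ ≤ 1 then betaConst β k * (1 - ‖y‖ ^ 2) ^ β else 0) := rfl
  rw [h0, h]
  have h2 : ∫ y in Set.Ioi (0 : ℝ), y ^ (finrank ℝ (EuclideanSpace ℝ (Fin k)) - 1) •
      (if y ≤ 1 then betaConst β k * (1 - y ^ 2) ^ β else 0) =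
      betaConst β k * B / 2 := by
    trans betaConst β k * B / 2 * ∫ x in Set.Ioi (0 : ℝ), (2 * x ^ ((2 : ℝ) - 1)) • q (x ^ (2 : ℝ))
    swap
    · rw [hq1, mul_one]
    rw [← integral_const_mul]
    apply setIntegral_congr_ae measurableSet_Ioi
    have hne : ∀ᵐ y : ℝ, y ≠ 1 := by simp [ae_iff]
    filter_upwards [hne] with y hy1 hy0
    have hy0 : 0 < y := hy0
    simp only [finrank_euclideanSpace, Fintype.card_fin, smul_eq_mul]
    rcases lt_or_gt_of_ne hy1 with hlt | hgt
    · have hy2 : y ^ (2 : ℝ) = y ^ 2 := by norm_num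
      have hy3 : y ^ 2 < 1 := by nlinarith
      rw [if_pos hlt.le, hq, ProbabilityTheory.betaPDFReal, hy2,
        if_pos ⟨by positivity, hy3⟩, ← hB]
      have e1 : (y ^ 2) ^ ((k : ℝ) / 2 - 1) * y = y ^ (k - 1) := by
        rw [← hy2, ← Real.rpow_mul hy0.le]
        nth_rewrite 2 [← Real.rpow_one y]
        rw [← Real.rpow_add hy0, ← Real.rpow_natCast, Nat.cast_sub hk]
        congr 1
        push_cast; ring
      have e2 : y ^ ((2 : ℝ) - 1) = y := by norm_num
      rw [e2, ← e1]
      have e3 : β + 1 - 1 = β := by ring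
      rw [e3]
      field_simp
    · rw [if_neg (not_le.2 hgt), hq, ProbabilityTheory.betaPDFReal, if_neg]
      · simp
      · rintro ⟨-, h2⟩
        have := Real.one_lt_rpow hgt (z := 2) (by norm_num)
        linarith
  rw [h2, Measure.real, EuclideanSpace.volume_ball]
  simp only [finrank_euclideanSpace, Fintype.card_fin, ENNReal.ofReal_one, one_pow, one_mul]
  have hG1 : 0 < Real.Gamma ((k : ℝ) / 2) := Real.Gamma_pos_of_pos (by positivity)
  have hG2 : 0 < Real.Gamma (β + 1) := Real.Gamma_pos_of_pos (by positivity)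
  have hG3 : 0 < Real.Gamma ((k : ℝ) / 2 + β + 1) := Real.Gamma_pos_of_pos (by positivity)
  have hG4 : Real.Gamma ((k : ℝ) / 2 + 1) = k / 2 * Real.Gamma (k / 2) :=
    Real.Gamma_add_one (by positivity)
  rw [ENNReal.toReal_ofReal (by rw [hG4]; positivity), hG4, betaConst, hB,
    ProbabilityTheory.beta, ← add_assoc]
  have hpi : √Real.pi ^ k = Real.pi ^ ((k : ℝ) / 2) := by
    rw [Real.sqrt_eq_rpow, ← Real.rpow_natCast, ← Real.rpow_mul Real.pi_pos.le]
    congr 1; ring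
  rw [hpi]
  have : 0 < Real.pi ^ ((k : ℝ) / 2) := by positivity
  simp only [smul_eq_mul, nsmul_eq_mul]
  field_simp

theorem isProbabilityMeasure_betaMeasure {β : ℝ} (hβ : 0 ≤ β) {k : ℕ} (hk : 1 ≤ k) :
    IsProbabilityMeasure (betaMeasure β k) := by
  constructor
  have h1 := integral_betaDensity hβ hk
  have hint : Integrable (betaDensity β k) := by
    by_contra h
    rw [integral_undef h] at h1
    exact zero_ne_one h1
  rw [betaMeasure, withDensity_apply _ MeasurableSet.univ, setLIntegral_univ,
    ← ofReal_integral_eq_lintegral_ofReal hint (ae_of_all _ (betaDensity_nonneg hβ k)), h1]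
  simp

theorem betaMeasure_le_of_density_le {β : ℝ} {k : ℕ} {s : Set (EuclideanSpace ℝ (Fin k))} {D : ℝ}
    (h : ∀ y ∈ s, betaDensity β k y ≤ D) :
    betaMeasure β k s ≤ ENNReal.ofReal D * volume s := by
  rw [betaMeasure, withDensity_apply' _ s, ← setLIntegral_const]
  exact setLIntegral_mono measurable_const fun y hy => ENNReal.ofReal_le_ofReal (h y hy)

theorem le_betaMeasure_of_le_density {β : ℝ} {k : ℕ} {s : Set (EuclideanSpace ℝ (Fin k))} {D : ℝ}
    (hs : MeasurableSet s) (h : ∀ y ∈ s, D ≤ betaDensity β k y) :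
    ENNReal.ofReal D * volume s ≤ betaMeasure β k s := by
  rw [betaMeasure, withDensity_apply' _ s, ← setLIntegral_const]
  exact setLIntegral_mono_ae' hs (ae_of_all _ fun y hy => ENNReal.ofReal_le_ofReal (h y hy))

end BetaMeasure

section Caps

open Module

theorem exists_orthogonal_coordinates {k : ℕ} {u : EuclideanSpace ℝ (Fin (k + 1))} (hu : ‖u‖ = 1) :
    ∃ w : Fin k → EuclideanSpace ℝ (Fin (k + 1)),
      (∀ y, ‖y‖ ^ 2 = inner ℝ u y ^ 2 + ∑ j, inner ℝ (w j) y ^ 2) ∧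
      ∀ a b δ : ℝ, volume {y | inner ℝ u y ∈ Set.Icc a b ∧ ∀ j, inner ℝ (w j) y ∈ Set.Icc (-δ) δ} =
        ENNReal.ofReal (b - a) * ENNReal.ofReal (2 * δ) ^ k := by
  have hon : Orthonormal ℝ (({0} : Set (Fin (k + 1))).domRestrict fun _ => u) := by
    refine ⟨fun _ => hu, fun i j hij => absurd (Subsingleton.elim i j) hij⟩
  obtain ⟨b, hb⟩ := hon.exists_orthonormalBasis_extension_of_card_eq (by simp)
  have hb0 : b 0 = u := hb 0 rfl
  refine ⟨fun j => b j.succ, fun y => ?_, fun a c δ => ?_⟩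
  · rw [← b.sum_sq_norm_inner_right y, Fin.sum_univ_succ, hb0]
    simp
  · have hmp : MeasurePreserving (fun y => WithLp.ofLp (b.repr y)) :=
      (PiLp.volume_preserving_ofLp (Fin (k + 1))).comp b.measurePreserving_repr
    have hpre := hmp.measure_preimage (s := Set.Icc (Fin.cons a fun _ => -δ) (Fin.cons c fun _ => δ))
      measurableSet_Icc.nullMeasurableSet
    rw [Real.volume_Icc_pi, Fin.prod_univ_succ] at hpre
    convert hpre using 2
    · ext y
      simp only [Set.mem_preimage, Set.mem_Icc, Pi.le_def, Fin.forall_fin_succ, Set.mem_ofPred_eq,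
        b.repr_apply_apply, Fin.cons_zero, Fin.cons_succ, hb0]
      constructor
      · rintro ⟨h1, h2⟩
        exact ⟨⟨h1.1, fun j => (h2 j).1⟩, h1.2, fun j => (h2 j).2⟩
      · rintro ⟨h1, h2⟩
        exact ⟨⟨h1.1, h2.1⟩, fun j => ⟨h1.2 j, h2.2 j⟩⟩
    · simp
    · simp only [Fin.cons_succ, sub_neg_eq_add, Finset.prod_const, Finset.card_univ,
        Fintype.card_fin, two_mul]

/-- The cap of height `h` in direction `u` of the unit ball. -/
def ballCap {E : Type*} [NormedAddCommGroup E] [InnerProductSpace ℝ E] (u : E) (h : ℝ) : Set E :=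
  {y | ‖y‖ ≤ 1 ∧ 1 - inner ℝ u y ≤ h}

theorem isClosed_ballCap {E : Type*} [NormedAddCommGroup E] [InnerProductSpace ℝ E] (u : E) (h : ℝ) :
    IsClosed (ballCap u h) :=
  (isClosed_le (f := fun y : E => ‖y‖) (by fun_prop) continuous_const).inter
    (isClosed_le (f := fun y : E => 1 - inner ℝ u y) (by fun_prop) continuous_const)

theorem betaMeasure_ballCap_le {β : ℝ} (hβ : 0 ≤ β) {k : ℕ} (hk : 1 ≤ k) :
    ∃ C : ℝ, 0 < C ∧ ∀ u : EuclideanSpace ℝ (Fin k), ‖u‖ = 1 → ∀ h : ℝ, 0 < h →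
      betaMeasure β k (ballCap u h) ≤ ENNReal.ofReal (C * h ^ (β + ((k : ℝ) + 1) / 2)) := by
  obtain ⟨k, rfl⟩ : ∃ k', k = k' + 1 := ⟨k - 1, by omega⟩
  have hc := betaConst_pos hβ (k + 1)
  refine ⟨betaConst β (k + 1) * 2 ^ β * (2 * √2) ^ k, by positivity, fun u hu h hh => ?_⟩
  obtain ⟨w, hw, hvol⟩ := exists_orthogonal_coordinates hu
  have key : ∀ y ∈ ballCap u h, 1 - inner ℝ u y ^ 2 ≤ 2 * h ∧ inner ℝ u y ≤ 1 := by
    rintro y ⟨hy1, hy2⟩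
    have h1 : inner ℝ u y ^ 2 ≤ 1 := by
      have := hw y
      have h3 : 0 ≤ ∑ j, inner ℝ (w j) y ^ 2 := by positivity
      nlinarith [norm_nonneg y]
    have h2 := abs_le_one_iff_mul_self_le_one.2 (by nlinarith : inner ℝ u y * inner ℝ u y ≤ 1)
    rw [abs_le] at h2
    constructor
    · nlinarith
    · exact h2.2
  have hsub : ballCap u h ⊆ {y | inner ℝ u y ∈ Set.Icc (1 - h) 1 ∧
      ∀ j, inner ℝ (w j) y ∈ Set.Icc (-√(2 * h)) √(2 * h)} := by
    intro y hy
    obtain ⟨k1, k2⟩ := key y hy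
    refine ⟨⟨by linarith [hy.2], k2⟩, fun j => ?_⟩
    have h3 : inner ℝ (w j) y ^ 2 ≤ ∑ j, inner ℝ (w j) y ^ 2 :=
      Finset.single_le_sum (f := fun j => inner ℝ (w j) y ^ 2) (fun _ _ => sq_nonneg _)
        (Finset.mem_univ j)
    have h4 := hw y
    exact abs_le.1 (Real.abs_le_sqrt (by nlinarith [norm_nonneg y, hy.1]))
  have hden : ∀ y ∈ ballCap u h, betaDensity β (k + 1) y ≤ betaConst β (k + 1) * (2 * h) ^ β := by
    intro y hy
    obtain ⟨k1, k2⟩ := key y hy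
    have h3 : 0 ≤ ∑ j, inner ℝ (w j) y ^ 2 := by positivity
    rw [betaDensity, if_pos hy.1]
    have h4 : 0 ≤ 1 - ‖y‖ ^ 2 := by nlinarith [norm_nonneg y, hy.1]
    gcongr
    linarith [hw y]
  refine (betaMeasure_le_of_density_le hden).trans ?_
  calc _ ≤ ENNReal.ofReal (betaConst β (k + 1) * (2 * h) ^ β) *
        (ENNReal.ofReal (1 - (1 - h)) * ENNReal.ofReal (2 * √(2 * h)) ^ k) := by
        rw [← hvol]; gcongr
    _ = _ := by
      rw [← ENNReal.ofReal_pow (by positivity), ← ENNReal.ofReal_mul (by linarith),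
        ← ENNReal.ofReal_mul (by positivity)]
      congr 1
      rw [Real.mul_rpow (by norm_num) hh.le, Real.sqrt_mul (by norm_num)]
      have e : h ^ (β + (((k + 1 : ℕ) : ℝ) + 1) / 2) = h ^ β * h * √h ^ k := by
        rw [Real.sqrt_eq_rpow, ← Real.rpow_natCast (h ^ (1 / 2 : ℝ)), ← Real.rpow_mul hh.le]
        nth_rewrite 3 [← Real.rpow_one h]
        rw [← Real.rpow_add hh, ← Real.rpow_add hh]
        congr 1; push_cast; ring
      rw [e]; ring

theorem le_betaMeasure_inner_cap {β : ℝ} (hβ : 0 ≤ β) {k : ℕ} (hk : 1 ≤ k) :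
    ∃ c : ℝ, 0 < c ∧ ∀ u : EuclideanSpace ℝ (Fin k), ‖u‖ = 1 → ∀ a : ℝ, 0 < a → a ≤ 1 →
      ENNReal.ofReal (c * a ^ (β + ((k : ℝ) + 1) / 2)) ≤
        betaMeasure β k {z | 1 - inner ℝ u z ≤ a ∧ a / 4 ≤ 1 - ‖z‖} := by
  obtain ⟨k, rfl⟩ : ∃ k', k = k' + 1 := ⟨k - 1, by omega⟩
  have hc := betaConst_pos hβ (k + 1)
  set κ : ℝ := 1 / (4 * (k + 1)) with hκ
  have hκ0 : 0 < κ := by positivity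
  refine ⟨betaConst β (k + 1) * (1 / 2) ^ β * (1 / 2) * (2 * √κ) ^ k, by positivity,
    fun u hu a ha ha1 => ?_⟩
  obtain ⟨w, hw, hvol⟩ := exists_orthogonal_coordinates hu
  set S := {y | inner ℝ u y ∈ Set.Icc (1 - a) (1 - a / 2) ∧
      ∀ j, inner ℝ (w j) y ∈ Set.Icc (-√(κ * a)) √(κ * a)} with hS
  have hSm : MeasurableSet S := by
    apply IsClosed.measurableSet
    simp only [hS, Set.mem_Icc, Set.ofPred_and, Set.ofPred_forall]
    refine IsClosed.inter (IsClosed.inter ?_ ?_) (isClosed_iInter fun i => IsClosed.inter ?_ ?_) <;>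
    exact isClosed_le (by fun_prop) (by fun_prop)
  have key : ∀ y ∈ S, ‖y‖ ^ 2 ≤ 1 - a / 2 := by
    rintro y ⟨⟨h1, h2⟩, h3⟩
    have h4 : ∑ j, inner ℝ (w j) y ^ 2 ≤ ∑ j : Fin k, κ * a := by
      refine Finset.sum_le_sum fun j _ => ?_
      have := abs_le.2 (h3 j)
      rw [← Real.sqrt_sq_eq_abs] at this
      exact (Real.sqrt_le_sqrt_iff (by positivity)).1 this
    have h5 : ∑ j : Fin k, κ * a ≤ a / 4 := by
      simp only [Finset.sum_const, Finset.card_univ, Fintype.card_fin, nsmul_eq_mul]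
      rw [hκ]
      have : (k : ℝ) * (1 / (4 * (k + 1)) * a) = (k / (k + 1)) * (a / 4) := by field_simp
      rw [this]
      have : (k : ℝ) / (k + 1) ≤ 1 := by rw [div_le_one (by positivity)]; linarith
      nlinarith
    rw [hw y]
    nlinarith
  have hden : ∀ y ∈ S, betaConst β (k + 1) * (a / 2) ^ β ≤ betaDensity β (k + 1) y := by
    intro y hy
    have := key y hy
    rw [betaDensity, if_pos (by nlinarith [norm_nonneg y])]
    gcongr
    linarith
  have hsub : S ⊆ {z | 1 - inner ℝ u z ≤ a ∧ a / 4 ≤ 1 - ‖z‖} := by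
    intro y hy
    refine ⟨by linarith [hy.1.1], ?_⟩
    have := key y hy
    nlinarith [norm_nonneg y]
  refine le_trans ?_ (measure_mono hsub)
  refine le_trans (le_of_eq ?_) (le_betaMeasure_of_le_density hSm hden)
  rw [hvol, ← ENNReal.ofReal_pow (by positivity), ← ENNReal.ofReal_mul (by linarith),
        ← ENNReal.ofReal_mul (by positivity)]
  congr 1
  rw [div_eq_mul_one_div a 2, Real.mul_rpow ha.le (by norm_num), Real.sqrt_mul hκ0.le]
  have e : a ^ (β + (((k + 1 : ℕ) : ℝ) + 1) / 2) = a ^ β * a * √a ^ k := by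
    rw [Real.sqrt_eq_rpow, ← Real.rpow_natCast (a ^ (1 / 2 : ℝ)), ← Real.rpow_mul ha.le]
    nth_rewrite 3 [← Real.rpow_one a]
    rw [← Real.rpow_add ha, ← Real.rpow_add ha]
    congr 1; push_cast; ring
  rw [e]; ring

theorem volume_closedBall_sdiff_ball {k : ℕ} {a b : ℝ} (ha : 0 < a) (hab : a ≤ b) :
    volume (Metric.closedBall (0 : EuclideanSpace ℝ (Fin k)) b \ Metric.ball 0 a) =
      ENNReal.ofReal (b ^ k - a ^ k) *
        volume (Metric.ball (0 : EuclideanSpace ℝ (Fin k)) 1) := by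
  rw [measure_sdiff (Metric.ball_subset_closedBall.trans (Metric.closedBall_subset_closedBall hab))
      measurableSet_ball.nullMeasurableSet measure_ball_lt_top.ne,
    Measure.addHaar_closedBall _ _ (ha.le.trans hab)]
  rw [Measure.addHaar_ball_of_pos _ _ ha, ENNReal.ofReal_sub _ (by positivity),
    ENNReal.sub_mul fun _ _ => measure_ball_lt_top.ne]
  simp

theorem betaMeasure_tail_le {β : ℝ} (hβ : 0 ≤ β) {k : ℕ} (hk : 1 ≤ k) :
    ∃ C : ℝ, 0 < C ∧ ∀ h : ℝ, 0 < h →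
      betaMeasure β k {y | 1 - ‖y‖ ≤ h} ≤ ENNReal.ofReal (C * h ^ (β + 1)) := by
  have hc := betaConst_pos hβ k
  have hk' : (0 : ℝ) < k := by exact_mod_cast hk
  set V := (volume (Metric.ball (0 : EuclideanSpace ℝ (Fin k)) 1)) with hV
  have hVt : V ≠ ⊤ := by rw [hV]; exact measure_ball_lt_top.ne
  have hprob := isProbabilityMeasure_betaMeasure hβ hk
  refine ⟨1 + betaConst β k * 2 ^ β * k * V.toReal, by positivity, fun h hh => ?_⟩
  rcases le_or_gt 1 h with h1 | h1
  · refine prob_le_one.trans ?_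
    rw [← ENNReal.ofReal_one]
    refine ENNReal.ofReal_le_ofReal ?_
    have h2 : 1 ≤ h ^ (β + 1) := Real.one_le_rpow h1 (by positivity)
    have h3 : 0 ≤ betaConst β k * 2 ^ β * k * V.toReal := by positivity
    nlinarith
  set S := Metric.closedBall (0 : EuclideanSpace ℝ (Fin k)) 1 \ Metric.ball 0 (1 - h) with hS
  have hsub : {y : EuclideanSpace ℝ (Fin k) | 1 - ‖y‖ ≤ h} ⊆ S ∪ {y | 1 < ‖y‖} := by
    intro y hy
    have hy : 1 - ‖y‖ ≤ h := hy
    rcases le_or_gt ‖y‖ 1 with h2 | h2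
    · left
      simp only [hS, Set.mem_sdiff, mem_closedBall_zero_iff, mem_ball_zero_iff, not_lt]
      exact ⟨h2, by linarith⟩
    · exact Or.inr h2
  have hout : betaMeasure β k {y | 1 < ‖y‖} = 0 := by
    have := betaMeasure_le_of_density_le (β := β) (k := k) (s := {y | 1 < ‖y‖}) (D := 0)
      fun y hy => by rw [betaDensity, if_neg (not_le.2 hy)]
    simpa using this
  have hden : ∀ y ∈ S, betaDensity β k y ≤ betaConst β k * (2 * h) ^ β := by
    intro y hy
    simp only [hS, Set.mem_sdiff, mem_closedBall_zero_iff, mem_ball_zero_iff, not_lt] at hy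
    rw [betaDensity, if_pos hy.1]
    have h4 : 0 ≤ 1 - ‖y‖ ^ 2 := by nlinarith [norm_nonneg y, hy.1]
    gcongr
    nlinarith [norm_nonneg y]
  calc _ ≤ betaMeasure β k S + betaMeasure β k {y | 1 < ‖y‖} :=
        (measure_mono hsub).trans (measure_union_le _ _)
    _ ≤ ENNReal.ofReal (betaConst β k * (2 * h) ^ β) * volume S := by
        rw [hout, add_zero]; exact betaMeasure_le_of_density_le hden
    _ ≤ ENNReal.ofReal (betaConst β k * (2 * h) ^ β) * (ENNReal.ofReal (k * h) * V) := by
        rw [hS, volume_closedBall_sdiff_ball (by linarith) (by linarith)]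
        gcongr
        have := one_add_mul_le_pow (a := -h) (by linarith) k
        rw [one_pow]
        have e : 1 - h = 1 + -h := by ring
        rw [e]
        linarith
    _ = ENNReal.ofReal ((betaConst β k * 2 ^ β * k * V.toReal) * h ^ (β + 1)) := by
        rw [← ENNReal.ofReal_toReal hVt, ← ENNReal.ofReal_mul (by positivity),
          ← ENNReal.ofReal_mul (by positivity), Real.mul_rpow (by norm_num) hh.le,
          Real.rpow_add_one hh.ne']
        simp only [ENNReal.toReal_ofReal ENNReal.toReal_nonneg]
        congr 1; ring
    _ ≤ _ := by gcongr; linarith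

theorem le_betaMeasure_shell {β : ℝ} (hβ : 0 ≤ β) {k : ℕ} (hk : 1 ≤ k) :
    ∃ c : ℝ, 0 < c ∧ ∀ h : ℝ, 0 < h → h ≤ 1 →
      ENNReal.ofReal (c * h ^ (β + 1)) ≤ betaMeasure β k {y | h / 2 ≤ 1 - ‖y‖ ∧ 1 - ‖y‖ ≤ h} := by
  have hc := betaConst_pos hβ k
  have : Nonempty (Fin k) := ⟨⟨0, hk⟩⟩
  set V := (volume (Metric.ball (0 : EuclideanSpace ℝ (Fin k)) 1)) with hV
  have hVt : V ≠ ⊤ := by rw [hV]; exact measure_ball_lt_top.ne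
  have hV0 : 0 < V.toReal := ENNReal.toReal_pos (Metric.measure_ball_pos _ _ one_pos).ne' hVt
  refine ⟨betaConst β k * (1 / 2) ^ β * (1 / 4) * (1 / 2) ^ (k - 1) * V.toReal, by positivity,
    fun h hh hh1 => ?_⟩
  set S := Metric.closedBall (0 : EuclideanSpace ℝ (Fin k)) (1 - h / 2) \
    Metric.ball 0 (1 - 3 * h / 4) with hS
  have hSm : MeasurableSet S := measurableSet_closedBall.diff measurableSet_ball
  have hden : ∀ y ∈ S, betaConst β k * (h / 2) ^ β ≤ betaDensity β k y := by
    intro y hy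
    simp only [hS, Set.mem_sdiff, mem_closedBall_zero_iff, mem_ball_zero_iff, not_lt] at hy
    rw [betaDensity, if_pos (by linarith)]
    gcongr
    nlinarith [norm_nonneg y]
  have hsub : S ⊆ {y | h / 2 ≤ 1 - ‖y‖ ∧ 1 - ‖y‖ ≤ h} := by
    intro y hy
    simp only [hS, Set.mem_sdiff, mem_closedBall_zero_iff, mem_ball_zero_iff, not_lt] at hy
    exact ⟨by linarith, by linarith⟩
  calc ENNReal.ofReal (betaConst β k * (1 / 2) ^ β * (1 / 4) * (1 / 2) ^ (k - 1) * V.toReal *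
        h ^ (β + 1))
      = ENNReal.ofReal (betaConst β k * (h / 2) ^ β) *
          (ENNReal.ofReal (h / 4 * (1 / 2) ^ (k - 1)) * V) := by
        rw [← ENNReal.ofReal_toReal hVt, ← ENNReal.ofReal_mul (by positivity),
          ← ENNReal.ofReal_mul (by positivity), div_eq_mul_one_div h 2,
          Real.mul_rpow hh.le (by norm_num), Real.rpow_add_one hh.ne']
        simp only [ENNReal.toReal_ofReal ENNReal.toReal_nonneg]
        congr 1; ring
    _ ≤ ENNReal.ofReal (betaConst β k * (h / 2) ^ β) * volume S := by
        rw [hS, volume_closedBall_sdiff_ball (by linarith) (by linarith)]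
        gcongr
        obtain ⟨l, rfl⟩ : ∃ l, k = l + 1 := ⟨k - 1, by omega⟩
        have h1 : (1 - 3 * h / 4) ^ l ≤ (1 - h / 2) ^ l :=
          pow_le_pow_left₀ (by linarith) (by linarith) l
        have h2 : (1 / 2 : ℝ) ^ l ≤ (1 - h / 2) ^ l :=
          pow_le_pow_left₀ (by linarith) (by linarith) l
        simp only [pow_succ, Nat.add_sub_cancel]
        nlinarith
    _ ≤ betaMeasure β k S := le_betaMeasure_of_le_density hSm hden
    _ ≤ _ := measure_mono hsub

end Caps

section CapGeometry

theorem one_sub_inner_le {V : Type*} [NormedAddCommGroup V] [InnerProductSpace ℝ V] {u v y : V}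
    (hu : ‖u‖ = 1) (hv : ‖v‖ = 1) (hy : ‖y‖ ≤ 1) :
    1 - inner ℝ v y ≤ 2 * (1 - inner ℝ u y) + 2 * (1 - inner ℝ u v) := by
  have h0 := parallelogram_law_with_norm ℝ (v - u) (u - y)
  have e1 : v - u + (u - y) = v - y := by abel
  rw [e1] at h0
  have h1 := norm_sub_sq_real v u
  have h2 := norm_sub_sq_real u y
  have h3 := norm_sub_sq_real v y
  rw [hu, hv, real_inner_comm] at h1
  rw [hu] at h2
  rw [hv] at h3
  have h4 := mul_self_nonneg ‖v - u - (u - y)‖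
  nlinarith [norm_nonneg y]

/-- The unit vector in the direction of `z`. -/
def unitDir {V : Type*} [NormedAddCommGroup V] [NormedSpace ℝ V] (z : V) : V := ‖z‖⁻¹ • z

theorem norm_unitDir {V : Type*} [NormedAddCommGroup V] [NormedSpace ℝ V] {z : V} (hz : z ≠ 0) :
    ‖unitDir z‖ = 1 := by
  rw [unitDir, norm_smul, norm_inv, norm_norm, inv_mul_cancel₀ (norm_ne_zero_iff.2 hz)]

theorem ballCap_comparison {V : Type*} [NormedAddCommGroup V] [InnerProductSpace ℝ V] {u z : V}
    {ε h : ℝ} (hu : ‖u‖ = 1) (hε : 0 < ε) (hε' : ε ≤ 1 / 4) (hh : 0 < h) (hh2 : h ≤ 2)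
    (hz1 : 1 - inner ℝ u z ≤ ε * h) (hz2 : ε * h / 4 ≤ 1 - ‖z‖) :
    z ≠ 0 ∧ 0 < 1 - ‖z‖ ∧ 1 - ‖z‖ ≤ ε * h ∧
      ballCap u h ⊆ ballCap (unitDir z) (16 / ε * (1 - ‖z‖)) ∧
      ballCap (unitDir z) (1 - ‖z‖) ⊆ {y | 1 - inner ℝ u y ≤ 4 * ε * h} := by
  have hεh : 0 < ε * h := by positivity
  have h1 : ε * h ≤ 1 / 2 := by nlinarith
  have hin : 0 < inner ℝ u z := by linarith
  have hz0 : z ≠ 0 := by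
    rintro rfl
    simp at hin
  have hle : inner ℝ u z ≤ ‖z‖ := by
    have := real_inner_le_norm u z
    rwa [hu, one_mul] at this
  have hnz : 0 < ‖z‖ := norm_pos_iff.2 hz0
  have hdir : 1 - inner ℝ u (unitDir z) ≤ ε * h := by
    rw [unitDir, real_inner_smul_right]
    have : inner ℝ u z ≤ ‖z‖⁻¹ * inner ℝ u z := by
      have : 1 ≤ ‖z‖⁻¹ := (one_le_inv₀ hnz).2 (by linarith)
      nlinarith
    linarith
  have hun := norm_unitDir hz0
  refine ⟨hz0, by linarith, by linarith, fun y hy => ⟨hy.1, ?_⟩, fun y hy => ?_⟩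
  · have := one_sub_inner_le hu hun hy.1
    have h3 := hy.2
    have h4 : 16 / ε * (ε * h / 4) ≤ 16 / ε * (1 - ‖z‖) := by gcongr
    have h5 : 16 / ε * (ε * h / 4) = 4 * h := by field_simp; norm_num
    nlinarith
  · have := one_sub_inner_le hun hu hy.1
    have h3 := hy.2
    rw [real_inner_comm] at hdir
    simp only [Set.mem_ofPred_eq]
    linarith

variable {ι : Type*} [Fintype ι] {V : ι → Type*} [∀ i, NormedAddCommGroup (V i)]
  [∀ i, InnerProductSpace ℝ (V i)]

theorem exists_eq_sum_inner [∀ i, CompleteSpace (V i)] (f : (Π i, V i) →L[ℝ] ℝ) :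
    ∃ a : Π i, V i, ∀ y, f y = ∑ i, inner ℝ (a i) (y i) := by
  classical
  refine ⟨fun i => (InnerProductSpace.toDual ℝ (V i)).symm (f.comp (ContinuousLinearMap.single ℝ V i)),
    fun y => ?_⟩
  conv_lhs => rw [← Finset.univ_sum_single y]
  rw [map_sum]
  refine Finset.sum_congr rfl fun i _ => ?_
  rw [InnerProductSpace.toDual_symm_apply]
  simp

theorem exists_caps_of_isExposedIndexSet [∀ i, CompleteSpace (V i)] [∀ i, Nontrivial (V i)]
    [Nonempty ι] {κ : Type*} {x : κ → Π i, V i} (hx : ∀ k i, ‖x k i‖ < 1) {J : Finset κ}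
    (hJ : J.Nonempty) (h : IsExposedIndexSet x J) :
    ∃ (u : Π i, V i) (h : ι → ℝ), (∀ i, ‖u i‖ = 1) ∧ (∀ i, 0 < h i ∧ h i ≤ 2) ∧
      (∀ k ∈ J, ∀ i, x k i ∈ ballCap (u i) (h i)) ∧
      ∀ k ∉ J, ∃ i, h i / Fintype.card ι ≤ 1 - inner ℝ (u i) (x k i) := by
  classical
  obtain ⟨f, c, h1, h2⟩ := h
  obtain ⟨a, ha⟩ := exists_eq_sum_inner f
  obtain ⟨k₀, hk₀⟩ := hJ
  have hcard : (0 : ℝ) < Fintype.card ι := by exact_mod_cast Fintype.card_pos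
  have hunit : ∀ i, ∃ e : V i, ‖e‖ = 1 := fun i => exists_norm_eq (V i) zero_le_one
  choose e he using hunit
  set u : Π i, V i := fun i => if a i = 0 then e i else unitDir (a i) with hu
  have hu1 : ∀ i, ‖u i‖ = 1 := by
    intro i
    by_cases h0 : a i = 0
    · simp [hu, h0, he]
    · simp [hu, h0, norm_unitDir]
  have hau : ∀ i, a i = ‖a i‖ • u i := by
    intro i
    by_cases h0 : a i = 0
    · simp [h0]
    · simp [hu, h0, unitDir, smul_smul, norm_ne_zero_iff.2 h0]
  have hinner_lt : ∀ i y, ‖y‖ < 1 → inner ℝ (u i) y < 1 := by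
    intro i y hy
    have := real_inner_le_norm (u i) y
    rw [hu1, one_mul] at this
    linarith
  have hinner_gt : ∀ i y, ‖y‖ < 1 → 1 - inner ℝ (u i) y ≤ 2 := by
    intro i y hy
    have := abs_le.1 (abs_real_inner_le_norm (u i) y)
    rw [hu1, one_mul] at this
    linarith
  have hf : ∀ y : Π i, V i, ∑ i, ‖a i‖ * (1 - inner ℝ (u i) (y i)) = ∑ i, ‖a i‖ - f y := by
    intro y
    rw [ha, ← Finset.sum_sub_distrib]
    refine Finset.sum_congr rfl fun i _ => ?_
    conv_rhs => rw [hau i, real_inner_smul_left, ← hau i]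
    ring
  set t := ∑ i, ‖a i‖ - c with ht
  have hterm : ∀ k i, 0 ≤ ‖a i‖ * (1 - inner ℝ (u i) (x k i)) := fun k i =>
    mul_nonneg (norm_nonneg _) (by linarith [hinner_lt i _ (hx k i)])
  have htJ : ∀ k ∈ J, ∑ i, ‖a i‖ * (1 - inner ℝ (u i) (x k i)) = t := by
    intro k hk
    rw [hf, h1 k hk]
  by_cases hall : ∀ i, a i = 0
  · refine ⟨u, fun _ => 2, hu1, fun _ => ⟨two_pos, le_rfl⟩,
      fun k _ i => ⟨(hx k i).le, hinner_gt i _ (hx k i)⟩, fun k hk => ?_⟩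
    have e1 := h2 k hk
    have e2 := h1 k₀ hk₀
    simp only [ha, hall, inner_zero_left, Finset.sum_const_zero] at e1 e2
    linarith
  push Not at hall
  obtain ⟨i₀, hi₀⟩ := hall
  have htpos : 0 < t := by
    rw [← htJ k₀ hk₀]
    refine Finset.sum_pos' (fun i _ => hterm k₀ i) ⟨i₀, Finset.mem_univ _, ?_⟩
    exact mul_pos (norm_pos_iff.2 hi₀) (by linarith [hinner_lt i₀ _ (hx k₀ i₀)])
  refine ⟨u, fun i => if a i = 0 then 2 else min 2 (t / ‖a i‖), hu1, fun i => ?_,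
    fun k hk i => ⟨(hx k i).le, ?_⟩, fun k hk => ?_⟩
  · by_cases h0 : a i = 0
    · simp [h0]
    · have : 0 < ‖a i‖ := norm_pos_iff.2 h0
      simp only [h0, if_false]
      exact ⟨by positivity, min_le_left _ _⟩
  · by_cases h0 : a i = 0
    · simpa [h0] using hinner_gt i _ (hx k i)
    · have h3 : 0 < ‖a i‖ := norm_pos_iff.2 h0
      simp only [h0, if_false]
      refine le_min (hinner_gt i _ (hx k i)) ((le_div_iff₀' h3).2 ?_)
      rw [← htJ k hk]
      exact Finset.single_le_sum (f := fun i => ‖a i‖ * (1 - inner ℝ (u i) (x k i)))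
        (fun i _ => hterm k i) (Finset.mem_univ i)
  · by_contra hcon
    push Not at hcon
    have h3 : ∑ i, ‖a i‖ * (1 - inner ℝ (u i) (x k i)) ≤ ∑ i : ι, t / Fintype.card ι := by
      refine Finset.sum_le_sum fun i _ => ?_
      by_cases h0 : a i = 0
      · simp only [h0, norm_zero, zero_mul]; positivity
      · have h4 : 0 < ‖a i‖ := norm_pos_iff.2 h0
        have h5 := hcon i
        simp only [h0, if_false] at h5
        calc ‖a i‖ * (1 - inner ℝ (u i) (x k i)) ≤ ‖a i‖ * (t / ‖a i‖ / Fintype.card ι) := by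
              gcongr
              exact h5.le.trans (by gcongr; exact min_le_right _ _)
          _ = _ := by field_simp
    rw [Finset.sum_const, Finset.card_univ, nsmul_eq_mul, mul_div_cancel₀ _ hcard.ne', hf] at h3
    linarith [h2 k hk]

end CapGeometry

section ExposedBound

set_option linter.unusedSectionVars false

/-- A measure on the unit ball for which caps of height `h` have mass of order `h ^ γ`. -/
structure IsCapRegular {V : Type*} [NormedAddCommGroup V] [InnerProductSpace ℝ V]
    [MeasurableSpace V] (ν : Measure V) (γ c C : ℝ) : Prop where
  c_pos : 0 < c
  C_pos : 0 < C
  norm_lt_one : ∀ᵐ y ∂ν, ‖y‖ < 1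
  ne_zero : ∀ᵐ y ∂ν, y ≠ 0
  cap_le : ∀ u : V, ‖u‖ = 1 → ∀ h : ℝ, 0 < h → ν (ballCap u h) ≤ ENNReal.ofReal (C * h ^ γ)
  le_inner_cap : ∀ u : V, ‖u‖ = 1 → ∀ a : ℝ, 0 < a → a ≤ 1 →
    ENNReal.ofReal (c * a ^ γ) ≤ ν {z | 1 - inner ℝ u z ≤ a ∧ a / 4 ≤ 1 - ‖z‖}

theorem IsCapRegular.le_cap {V : Type*} [NormedAddCommGroup V] [InnerProductSpace ℝ V]
    [MeasurableSpace V] {ν : Measure V} {γ c C : ℝ} (hν : IsCapRegular ν γ c C) {u : V}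
    (hu : ‖u‖ = 1) {a : ℝ} (ha : 0 < a) (ha1 : a ≤ 1) :
    ENNReal.ofReal (c * a ^ γ) ≤ ν (ballCap u a) :=
  (hν.le_inner_cap u hu a ha ha1).trans
    (measure_mono fun z hz => ⟨by linarith [hz.2], hz.1⟩)

variable {ι : Type*} [Fintype ι] {V : ι → Type*} [∀ i, NormedAddCommGroup (V i)]
  [∀ i, InnerProductSpace ℝ (V i)]

/-- The product of powers of the distances of the blocks of `z` to the unit spheres. -/
def boundaryProd (γ : ι → ℝ) (z : Π i, V i) : ℝ := ∏ i, (1 - ‖z i‖) ^ γ i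

/-- The product of the caps around the directions of the blocks of `z` whose heights are `K` times
the distance to the unit sphere. -/
def capProd (K : ℝ) (z : Π i, V i) : Set (Π i, V i) :=
  Set.univ.pi fun i => ballCap (unitDir (z i)) (K * (1 - ‖z i‖))

/-- The points of the product of open balls with no vanishing block. -/
def regularPoints (V : ι → Type*) [∀ i, NormedAddCommGroup (V i)] : Set (Π i, V i) :=
  {z | ∀ i, z i ≠ 0 ∧ ‖z i‖ < 1}

theorem boundaryProd_pos (γ : ι → ℝ) {z : Π i, V i} (hz : z ∈ regularPoints V) :
    0 < boundaryProd γ z :=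
  Finset.prod_pos fun i _ => Real.rpow_pos_of_pos (by linarith [(hz i).2]) _

theorem boundaryProd_le_one {γ : ι → ℝ} (hγ : ∀ i, 0 ≤ γ i) {z : Π i, V i}
    (hz : z ∈ regularPoints V) : boundaryProd γ z ≤ 1 :=
  Finset.prod_le_one (fun i _ => Real.rpow_nonneg (by linarith [(hz i).2]) _) fun i _ =>
    Real.rpow_le_one (by linarith [(hz i).2]) (by linarith [norm_nonneg (z i)]) (hγ i)

variable [∀ i, MeasurableSpace (V i)] [∀ i, BorelSpace (V i)]

theorem measurable_boundaryProd (γ : ι → ℝ) :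
    Measurable (boundaryProd γ : (Π i, V i) → ℝ) := by
  unfold boundaryProd
  fun_prop

theorem measure_capProd_le {ν : Π i, Measure (V i)} [∀ i, IsProbabilityMeasure (ν i)]
    {γ c C : ι → ℝ} (hν : ∀ i, IsCapRegular (ν i) (γ i) (c i) (C i)) {K : ℝ} (hK : 0 < K)
    {z : Π i, V i} (hz : z ∈ regularPoints V) :
    Measure.pi ν (capProd K z) ≤ ENNReal.ofReal ((∏ i, C i * K ^ γ i) * boundaryProd γ z) := by
  rw [capProd, Measure.pi_pi, boundaryProd, ← Finset.prod_mul_distrib,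
    ENNReal.ofReal_prod_of_nonneg fun i _ => by
      have := (hν i).C_pos
      have : 0 < 1 - ‖z i‖ := by linarith [(hz i).2]
      positivity]
  refine Finset.prod_le_prod' fun i _ => ?_
  have h1 : 0 < 1 - ‖z i‖ := by linarith [(hz i).2]
  refine ((hν i).cap_le _ (norm_unitDir (hz i).1) _ (by positivity)).trans (le_of_eq ?_)
  rw [Real.mul_rpow hK.le h1.le, mul_assoc]

theorem le_measure_capProd {ν : Π i, Measure (V i)} [∀ i, IsProbabilityMeasure (ν i)]
    {γ c C : ι → ℝ} (hν : ∀ i, IsCapRegular (ν i) (γ i) (c i) (C i))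
    {z : Π i, V i} (hz : z ∈ regularPoints V) :
    ENNReal.ofReal ((∏ i, c i) * boundaryProd γ z) ≤ Measure.pi ν (capProd 1 z) := by
  rw [capProd, Measure.pi_pi, boundaryProd, ← Finset.prod_mul_distrib,
    ENNReal.ofReal_prod_of_nonneg fun i _ => by
      have := (hν i).c_pos
      have : 0 < 1 - ‖z i‖ := by linarith [(hz i).2]
      positivity]
  refine Finset.prod_le_prod' fun i _ => ?_
  have h1 : 0 < 1 - ‖z i‖ := by linarith [(hz i).2]
  rw [one_mul]
  exact (hν i).le_cap (norm_unitDir (hz i).1) h1 (by linarith [norm_nonneg (z i)])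

theorem ae_mem_regularPoints {ν : Π i, Measure (V i)} [∀ i, IsProbabilityMeasure (ν i)]
    {γ c C : ι → ℝ} (hν : ∀ i, IsCapRegular (ν i) (γ i) (c i) (C i)) :
    ∀ᵐ z ∂Measure.pi ν, z ∈ regularPoints V := by
  simp only [regularPoints, Set.mem_ofPred_eq]
  rw [ae_all_iff]
  intro i
  exact (Measure.quasiMeasurePreserving_eval ν i).ae ((hν i).ne_zero.and (hν i).norm_lt_one)

theorem isClosed_capProd (K : ℝ) (z : Π i, V i) : IsClosed (capProd K z) :=
  isClosed_set_pi fun _ _ => isClosed_ballCap _ _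

variable [∀ i, SecondCountableTopology (V i)]

theorem measurableSet_mem_capProd {n : ℕ} (k : Fin n) (K : ℝ) : MeasurableSet
    {w : (Fin n → Π i, V i) × (Π i, V i) | w.1 k ∈ capProd K w.2} := by
  simp only [capProd, Set.mem_pi, Set.mem_univ, true_imp_iff, ballCap,
    Set.ofPred_forall, Set.ofPred_and, unitDir]
  refine MeasurableSet.iInter fun i => MeasurableSet.inter ?_ ?_
  · exact measurableSet_le (by fun_prop) measurable_const
  · exact measurableSet_le (by fun_prop) (by fun_prop)

/-- The pairs of a sample `x` and a point `z` such that the points of the sample lying in the small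
cap product at `z` all have index in `J`, and the points with index in `J` lie in the large one. -/
def samplePairs {n : ℕ} (J : Finset (Fin n)) (K : ℝ) : Set ((Fin n → Π i, V i) × (Π i, V i)) :=
  {w | w.2 ∈ regularPoints V ∧ (∀ k ∈ J, w.1 k ∈ capProd K w.2) ∧ ∀ k ∉ J, w.1 k ∉ capProd 1 w.2}

theorem measurableSet_regularPoints : MeasurableSet (regularPoints V) := by
  simp only [regularPoints, Set.ofPred_forall, Set.ofPred_and]
  refine MeasurableSet.iInter fun i => MeasurableSet.inter ?_ ?_
  · exact (measurableSet_singleton (0 : V i)).compl.preimage (measurable_pi_apply i)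
  · exact measurableSet_lt (by fun_prop) measurable_const

theorem measurableSet_samplePairs {n : ℕ} (J : Finset (Fin n)) (K : ℝ) :
    MeasurableSet (samplePairs (V := V) J K) := by
  simp only [samplePairs, Set.ofPred_and, Set.ofPred_forall]
  refine (measurableSet_regularPoints.preimage measurable_snd).inter (MeasurableSet.inter ?_ ?_)
  · exact MeasurableSet.iInter fun k => MeasurableSet.iInter fun _ => measurableSet_mem_capProd k K
  · exact MeasurableSet.iInter fun k => MeasurableSet.iInter fun _ =>
      (measurableSet_mem_capProd k 1).compl

end ExposedBound

section ExposedProbability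

set_option linter.unusedSectionVars false

variable {ι : Type*} [Fintype ι] [Nonempty ι] {V : ι → Type*} [∀ i, NormedAddCommGroup (V i)]
  [∀ i, InnerProductSpace ℝ (V i)] [∀ i, FiniteDimensional ℝ (V i)] [∀ i, Nontrivial (V i)]
  [∀ i, MeasurableSpace (V i)] [∀ i, BorelSpace (V i)] {ν : Π i, Measure (V i)}
  [∀ i, IsProbabilityMeasure (ν i)] {γ c C : ι → ℝ}

theorem one_le_lintegral_samplePairs (hν : ∀ i, IsCapRegular (ν i) (γ i) (c i) (C i))
    (hγ : ∀ i, 0 ≤ γ i) {n : ℕ} {J : Finset (Fin n)} (hJ : J.Nonempty) {x : Fin n → Π i, V i}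
    (hx : ∀ k i, ‖x k i‖ < 1) (h : IsExposedIndexSet x J) :
    1 ≤ ∫⁻ z, (samplePairs J (128 * Fintype.card ι)).indicator
      (fun w => ENNReal.ofReal ((∏ i, c i)⁻¹ * (boundaryProd γ w.2)⁻¹)) (x, z) ∂Measure.pi ν := by
  have hM : (1 : ℝ) ≤ Fintype.card ι := by exact_mod_cast Fintype.card_pos
  obtain ⟨u, h, hu, hh, hin, hout⟩ := exists_caps_of_isExposedIndexSet hx hJ h
  set M : ℝ := ((Fintype.card ι : ℕ) : ℝ) with hMdef
  set ε : ℝ := 1 / (8 * M) with hε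
  have hε0 : 0 < ε := by positivity
  have hε1 : ε ≤ 1 / 8 := by
    rw [hε]
    exact one_div_le_one_div_of_le (by norm_num) (by linarith)
  set G : Set (Π i, V i) := Set.univ.pi fun i =>
    {z | 1 - inner ℝ (u i) z ≤ ε * h i ∧ ε * h i / 4 ≤ 1 - ‖z‖} with hG
  have hcomp : ∀ z ∈ G, ∀ i, _ := fun z hz i =>
    ballCap_comparison (hu i) hε0 (by linarith) (hh i).1 (hh i).2 (hz i trivial).1 (hz i trivial).2
  set P := ∏ i, (ε * h i) ^ γ i with hP
  have hεh : ∀ i, 0 < ε * h i := fun i => mul_pos hε0 (hh i).1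
  have hP0 : 0 < P := Finset.prod_pos fun i _ => Real.rpow_pos_of_pos (hεh i) _
  have hc0 : 0 < ∏ i, c i := Finset.prod_pos fun i _ => (hν i).c_pos
  have hle : ∀ z ∈ G, ENNReal.ofReal ((∏ i, c i)⁻¹ * P⁻¹) ≤ (samplePairs J (128 * M)).indicator
      (fun w => ENNReal.ofReal ((∏ i, c i)⁻¹ * (boundaryProd γ w.2)⁻¹)) (x, z) := by
    intro z hz
    have hzr : z ∈ regularPoints V := fun i =>
      ⟨(hcomp z hz i).1, by linarith [(hcomp z hz i).2.1]⟩
    have hmem : (x, z) ∈ samplePairs (V := V) J (128 * M) := by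
      refine ⟨hzr, fun k hk i _ => ?_, fun k hk hk' => ?_⟩
      · have e : (16 : ℝ) / ε = 128 * M := by rw [hε]; field_simp; norm_num
        rw [← e]
        exact (hcomp z hz i).2.2.2.1 (hin k hk i)
      · obtain ⟨i, hi⟩ := hout k hk
        have h1 : x k i ∈ ballCap (unitDir (z i)) (1 * (1 - ‖z i‖)) := hk' i trivial
        rw [one_mul] at h1
        have h2 := (hcomp z hz i).2.2.2.2 h1
        simp only [Set.mem_ofPred_eq] at h2
        have e : 4 * ε * h i = h i / M / 2 := by rw [hε]; field_simp; ring
        have : 0 < h i / M := div_pos (hh i).1 (by linarith)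
        linarith
    rw [Set.indicator_of_mem hmem]
    gcongr
    · exact boundaryProd_pos γ hzr
    · refine Finset.prod_le_prod (fun i _ => Real.rpow_nonneg (hcomp z hz i).2.1.le _) fun i _ => ?_
      exact Real.rpow_le_rpow (hcomp z hz i).2.1.le (hcomp z hz i).2.2.1 (hγ i)
  have hGm : MeasurableSet G := by
    refine MeasurableSet.univ_pi fun i => MeasurableSet.inter ?_ ?_
    · exact measurableSet_le (f := fun y : V i => 1 - inner ℝ (u i) y) (by fun_prop)
        measurable_const
    · exact measurableSet_le measurable_const (g := fun y : V i => 1 - ‖y‖) (by fun_prop)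
  have hGν : ENNReal.ofReal ((∏ i, c i) * P) ≤ Measure.pi ν G := by
    rw [hG, Measure.pi_pi, hP, ← Finset.prod_mul_distrib,
      ENNReal.ofReal_prod_of_nonneg fun i _ =>
        mul_nonneg (hν i).c_pos.le (Real.rpow_nonneg (hεh i).le _)]
    refine Finset.prod_le_prod' fun i _ => ?_
    exact (hν i).le_inner_cap _ (hu i) _ (hεh i) (by nlinarith [(hh i).2, (hh i).1])
  calc (1 : ENNReal) = ENNReal.ofReal ((∏ i, c i)⁻¹ * P⁻¹) * ENNReal.ofReal ((∏ i, c i) * P) := by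
        rw [← ENNReal.ofReal_mul (by positivity), ← ENNReal.ofReal_one]
        congr 1
        field_simp
    _ ≤ ENNReal.ofReal ((∏ i, c i)⁻¹ * P⁻¹) * Measure.pi ν G := by gcongr
    _ = ∫⁻ z in G, ENNReal.ofReal ((∏ i, c i)⁻¹ * P⁻¹) ∂Measure.pi ν := (setLIntegral_const _ _).symm
    _ ≤ ∫⁻ z in G, (samplePairs J (128 * M)).indicator
      (fun w => ENNReal.ofReal ((∏ i, c i)⁻¹ * (boundaryProd γ w.2)⁻¹)) (x, z) ∂Measure.pi ν :=
        setLIntegral_mono_ae' hGm (ae_of_all _ hle)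
    _ ≤ _ := setLIntegral_le_lintegral _ _

theorem pi_samplePairs_le (hν : ∀ i, IsCapRegular (ν i) (γ i) (c i) (C i)) {n : ℕ}
    (J : Finset (Fin n)) {K : ℝ} (hK : 0 < K) {z : Π i, V i} (hz : z ∈ regularPoints V) :
    (Measure.pi fun _ : Fin n => Measure.pi ν) {x | (x, z) ∈ samplePairs J K} ≤
      ENNReal.ofReal (((∏ i, C i * K ^ γ i) * boundaryProd γ z) ^ J.card *
        Real.exp (-((∏ i, c i) * boundaryProd γ z * (n - J.card)))) := by
  classical
  set μ := Measure.pi ν with hμ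
  have hp := boundaryProd_pos γ hz
  have hc0 : 0 < ∏ i, c i := Finset.prod_pos fun i _ => (hν i).c_pos
  have hC0 : 0 < ∏ i, C i * K ^ γ i := Finset.prod_pos fun i _ =>
    mul_pos (hν i).C_pos (Real.rpow_pos_of_pos hK _)
  have hset : {x : Fin n → Π i, V i | (x, z) ∈ samplePairs J K} ⊆
      Set.univ.pi fun k => if k ∈ J then capProd K z else (capProd 1 z)ᶜ := by
    rintro x ⟨-, h1, h2⟩ k -
    by_cases hk : k ∈ J
    · simpa [hk] using h1 k hk
    · simpa [hk] using h2 k hk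
  have hcompl : μ (capProd 1 z)ᶜ ≤ ENNReal.ofReal (Real.exp (-((∏ i, c i) * boundaryProd γ z))) := by
    rw [prob_compl_eq_one_sub (isClosed_capProd 1 z).measurableSet]
    calc 1 - μ (capProd 1 z) ≤ 1 - ENNReal.ofReal ((∏ i, c i) * boundaryProd γ z) := by
          gcongr; exact le_measure_capProd hν hz
      _ = ENNReal.ofReal (1 - (∏ i, c i) * boundaryProd γ z) := by
          rw [ENNReal.ofReal_sub _ (by positivity), ENNReal.ofReal_one]
      _ ≤ _ := by
          gcongr
          have := Real.add_one_le_exp (-((∏ i, c i) * boundaryProd γ z))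
          linarith
  have hcard : J.card ≤ n := by simpa using J.card_le_univ
  calc _ ≤ ∏ k : Fin n, μ (if k ∈ J then capProd K z else (capProd 1 z)ᶜ) := by
        rw [← Measure.pi_pi]; exact measure_mono hset
    _ = μ (capProd K z) ^ J.card * μ (capProd 1 z)ᶜ ^ (n - J.card) := by
        simp_rw [apply_ite μ]
        rw [Finset.prod_ite]
        simp only [Finset.prod_const, Finset.filter_mem_eq_inter, Finset.univ_inter,
          Finset.filter_not, ← Finset.compl_eq_univ_sdiff, Finset.card_compl, Fintype.card_fin]
    _ ≤ ENNReal.ofReal ((∏ i, C i * K ^ γ i) * boundaryProd γ z) ^ J.card *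
          ENNReal.ofReal (Real.exp (-((∏ i, c i) * boundaryProd γ z))) ^ (n - J.card) := by
        gcongr
        exact measure_capProd_le hν hK hz
    _ = _ := by
        rw [← ENNReal.ofReal_pow (by positivity), ← ENNReal.ofReal_pow (by positivity),
          ← ENNReal.ofReal_mul (by positivity), ← Real.exp_nat_mul]
        congr 3
        rw [Nat.cast_sub hcard]
        ring

theorem measure_isExposedIndexSet_le (hν : ∀ i, IsCapRegular (ν i) (γ i) (c i) (C i))
    (hγ : ∀ i, 0 ≤ γ i) {n : ℕ} {J : Finset (Fin n)} {j : ℕ} (hJ : J.card = j + 1) :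
    (Measure.pi fun _ : Fin n => Measure.pi ν) {x | IsExposedIndexSet x J} ≤
      ENNReal.ofReal ((∏ i, c i)⁻¹ * (∏ i, C i * (128 * Fintype.card ι) ^ γ i) ^ (j + 1) *
          Real.exp ((∏ i, c i) * (j + 1))) *
        ∫⁻ z, ENNReal.ofReal (boundaryProd γ z ^ j *
          Real.exp (-((∏ i, c i) * (n * boundaryProd γ z)))) ∂Measure.pi ν := by
  set K : ℝ := 128 * Fintype.card ι with hK
  have hK0 : 0 < K := by
    have : (0 : ℝ) < Fintype.card ι := by exact_mod_cast Fintype.card_pos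
    positivity
  set μ := Measure.pi ν with hμ
  have hJne : J.Nonempty := Finset.card_pos.1 (by omega)
  have hc0 : 0 < ∏ i, c i := Finset.prod_pos fun i _ => (hν i).c_pos
  have hC0 : 0 < ∏ i, C i * K ^ γ i := Finset.prod_pos fun i _ =>
    mul_pos (hν i).C_pos (Real.rpow_pos_of_pos hK0 _)
  set g : (Π i, V i) → ENNReal :=
    fun z => ENNReal.ofReal ((∏ i, c i)⁻¹ * (boundaryProd γ z)⁻¹) with hg
  have hgm : Measurable g := by
    have := measurable_boundaryProd (V := V) γ
    fun_prop
  have hSm := measurableSet_samplePairs (V := V) J K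
  have hFm : Measurable ((samplePairs (V := V) J K).indicator fun w => g w.2) :=
    (hgm.comp measurable_snd).indicator hSm
  have hae : ∀ᵐ x ∂(Measure.pi fun _ : Fin n => μ), ∀ k i, ‖x k i‖ < 1 := by
    rw [ae_all_iff]
    intro k
    have := (Measure.quasiMeasurePreserving_eval (fun _ : Fin n => μ) k).ae
      (ae_mem_regularPoints hν)
    filter_upwards [this] with x hx i using (hx i).2
  have hexm := measurableSet_isExposedIndexSet (E := Π i, V i) J
  calc _ = ∫⁻ x, {x | IsExposedIndexSet x J}.indicator 1 x ∂(Measure.pi fun _ : Fin n => μ) :=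
        (lintegral_indicator_one hexm).symm
    _ ≤ ∫⁻ x, ∫⁻ z, (samplePairs (V := V) J K).indicator (fun w => g w.2) (x, z) ∂μ
          ∂(Measure.pi fun _ : Fin n => μ) := by
        refine lintegral_mono_ae ?_
        filter_upwards [hae] with x hx
        by_cases h : IsExposedIndexSet x J
        · rw [Set.indicator_of_mem (by exact h)]
          exact one_le_lintegral_samplePairs hν hγ hJne hx h
        · rw [Set.indicator_of_notMem (by exact h)]
          exact zero_le
    _ = ∫⁻ z, ∫⁻ x, (samplePairs (V := V) J K).indicator (fun w => g w.2) (x, z)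
          ∂(Measure.pi fun _ : Fin n => μ) ∂μ := lintegral_lintegral_swap hFm.aemeasurable
    _ ≤ ∫⁻ z, ENNReal.ofReal ((∏ i, c i)⁻¹ * (∏ i, C i * K ^ γ i) ^ (j + 1) *
          Real.exp ((∏ i, c i) * (j + 1))) * ENNReal.ofReal (boundaryProd γ z ^ j *
          Real.exp (-((∏ i, c i) * (n * boundaryProd γ z)))) ∂μ := by
        refine lintegral_mono_ae ?_
        filter_upwards [ae_mem_regularPoints hν] with z hz
        have hp := boundaryProd_pos γ hz
        have hp1 := boundaryProd_le_one hγ hz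
        have hm1 : MeasurableSet {x : Fin n → Π i, V i | (x, z) ∈ samplePairs J K} :=
          measurable_prodMk_right hSm
        have e1 : ∀ x : Fin n → Π i, V i, (samplePairs (V := V) J K).indicator (fun w => g w.2) (x, z)
            = {x | (x, z) ∈ samplePairs J K}.indicator (fun _ => g z) x := fun x => rfl
        simp_rw [e1]
        rw [lintegral_indicator_const hm1]
        refine (mul_le_mul_right (pi_samplePairs_le hν J hK0 hz) _).trans ?_
        rw [hg, ← ENNReal.ofReal_mul (by positivity), ← ENNReal.ofReal_mul (by positivity)]
        refine ENNReal.ofReal_le_ofReal ?_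
        rw [hJ]
        set p := boundaryProd γ z
        set a := ∏ i, c i
        set b := ∏ i, C i * K ^ γ i
        have e2 : Real.exp (-(a * p * (n - ((j + 1 : ℕ) : ℝ)))) ≤
            Real.exp (a * (j + 1)) * Real.exp (-(a * (n * p))) := by
          rw [← Real.exp_add]
          apply Real.exp_le_exp.2
          push_cast
          have : a * (j + 1) * p ≤ a * (j + 1) * 1 := by gcongr
          nlinarith
        calc a⁻¹ * p⁻¹ * ((b * p) ^ (j + 1) * Real.exp (-(a * p * (n - ((j + 1 : ℕ) : ℝ)))))
            ≤ a⁻¹ * p⁻¹ * ((b * p) ^ (j + 1) *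
              (Real.exp (a * (j + 1)) * Real.exp (-(a * (n * p))))) := by gcongr
          _ = _ := by field_simp; ring
    _ = _ := by
        rw [lintegral_const_mul']
        exact ENNReal.ofReal_ne_top

end ExposedProbability

section UpperBound

theorem pow_mul_exp_neg_le {a : ℝ} (ha : 0 < a) (j : ℕ) {s : ℝ} (hs : 0 ≤ s) :
    s ^ j * Real.exp (-(a * s)) ≤
      ((j + 2).factorial * Real.exp a / a ^ (j + 2)) * ((1 + s) ^ 2)⁻¹ := by
  have h1 := Real.pow_div_factorial_le_exp (a * (1 + s)) (by positivity) (j + 2)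
  rw [mul_pow, mul_add, mul_one, Real.exp_add, div_le_iff₀ (by positivity)] at h1
  rw [Real.exp_neg, ← div_eq_mul_inv, ← div_eq_mul_inv, div_div, div_le_div_iff₀ (by positivity)
    (by positivity)]
  calc s ^ j * (a ^ (j + 2) * (1 + s) ^ 2) ≤ (1 + s) ^ j * (a ^ (j + 2) * (1 + s) ^ 2) := by
        gcongr; linarith
    _ = a ^ (j + 2) * (1 + s) ^ (j + 2) := by ring
    _ ≤ _ := by linarith

theorem inv_one_add_sq_le_tsum {s : ℝ} (hs : 0 ≤ s) :
    ENNReal.ofReal ((1 + s) ^ 2)⁻¹ ≤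
      ∑' k : ℕ, {t : ℝ | t ≤ 2 ^ k}.indicator (fun _ => ENNReal.ofReal (4 * (1 / 4) ^ k)) s := by
  have hex : ∃ k : ℕ, s ≤ 2 ^ k := by
    obtain ⟨k, hk⟩ := pow_unbounded_of_one_lt s (one_lt_two)
    exact ⟨k, hk.le⟩
  classical
  refine le_trans ?_ (ENNReal.le_tsum (Nat.find hex))
  rw [Set.indicator_of_mem (by exact Nat.find_spec hex)]
  apply ENNReal.ofReal_le_ofReal
  rcases h : Nat.find hex with _ | k
  · have : ((1 + s) ^ 2)⁻¹ ≤ 1 := inv_le_one_of_one_le₀ (by nlinarith)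
    norm_num
    linarith
  · have h2 : (2 : ℝ) ^ k < s := by
      have := Nat.find_min hex (m := k) (by omega)
      push Not at this
      exact this
    have : ((1 + s) ^ 2)⁻¹ ≤ ((2 ^ k) ^ 2)⁻¹ := by
      gcongr
      linarith
    refine this.trans (le_of_eq ?_)
    rw [← pow_mul, mul_comm k 2, pow_mul]
    rw [show (2 : ℝ) ^ 2 = 4 by norm_num, pow_succ, one_div, inv_pow]
    ring

theorem lintegral_pow_mul_exp_neg_le {Ω : Type*} [MeasurableSpace Ω] (μ : Measure Ω)
    [IsProbabilityMeasure μ] {p : Ω → ℝ} (hp : Measurable p) (hp0 : ∀ᵐ z ∂μ, 0 ≤ p z) {α C : ℝ}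
    (hα : 0 ≤ α) (hα1 : α ≤ 1) (hC : 1 ≤ C) {q : ℕ}
    (htail : ∀ t : ℝ, 0 < t → t ≤ 1 →
      μ {z | p z ≤ t} ≤ ENNReal.ofReal (C * t ^ α * (1 - Real.log t) ^ q))
    {a : ℝ} (ha : 0 < a) (j : ℕ) {n : ℕ} (hn : 1 ≤ n) :
    ∫⁻ z, ENNReal.ofReal ((n * p z) ^ j * Real.exp (-(a * (n * p z)))) ∂μ ≤
      ENNReal.ofReal (((j + 2).factorial * Real.exp a / a ^ (j + 2)) * 8 * C *
        (n : ℝ) ^ (-α) * (1 + Real.log n) ^ q) := by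
  have hn' : (1 : ℝ) ≤ n := by exact_mod_cast hn
  have hn0 : (0 : ℝ) < n := by linarith
  have hlog : 0 ≤ Real.log n := Real.log_nonneg hn'
  set D : ℝ := (j + 2).factorial * Real.exp a / a ^ (j + 2) with hD
  have hD0 : 0 ≤ D := by positivity
  have htail' : ∀ k : ℕ, μ {z | n * p z ≤ 2 ^ k} ≤
      ENNReal.ofReal (C * (n : ℝ) ^ (-α) * (1 + Real.log n) ^ q * 2 ^ k) := by
    intro k
    have hset : {z | n * p z ≤ 2 ^ k} = {z | p z ≤ 2 ^ k / n} := by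
      ext z
      simp only [Set.mem_ofPred_eq]
      rw [le_div_iff₀ hn0, mul_comm]
    rw [hset]
    have hk : (1 : ℝ) ≤ 2 ^ k := one_le_pow₀ one_le_two
    have hpow : ((2 : ℝ) ^ k / n) ^ α ≤ (n : ℝ) ^ (-α) * 2 ^ k := by
      rw [Real.div_rpow (by positivity) hn0.le, Real.rpow_neg hn0.le, div_eq_inv_mul]
      gcongr
      calc ((2 : ℝ) ^ k) ^ α ≤ ((2 : ℝ) ^ k) ^ (1 : ℝ) := Real.rpow_le_rpow_of_exponent_le hk hα1
        _ = _ := Real.rpow_one _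
    by_cases h : (2 : ℝ) ^ k / n ≤ 1
    · refine (htail _ (by positivity) h).trans (ENNReal.ofReal_le_ofReal ?_)
      have hl : Real.log ((2 : ℝ) ^ k / n) = Real.log (2 ^ k) - Real.log n :=
        Real.log_div (by positivity) hn0.ne'
      have hl2 : 0 ≤ Real.log ((2 : ℝ) ^ k) := Real.log_nonneg hk
      have hl3 : 0 ≤ 1 - Real.log ((2 : ℝ) ^ k / n) := by
        have := Real.log_nonpos (by positivity) h
        linarith
      calc C * ((2 : ℝ) ^ k / n) ^ α * (1 - Real.log (2 ^ k / n)) ^ q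
          ≤ C * ((n : ℝ) ^ (-α) * 2 ^ k) * (1 + Real.log n) ^ q := by
            gcongr
            linarith
        _ = _ := by ring
    · push Not at h
      refine prob_le_one.trans ?_
      rw [← ENNReal.ofReal_one]
      apply ENNReal.ofReal_le_ofReal
      have h1 : 1 ≤ ((2 : ℝ) ^ k / n) ^ α := Real.one_le_rpow h.le hα
      have h2 : 1 ≤ (n : ℝ) ^ (-α) * 2 ^ k := h1.trans hpow
      have h3 : 1 ≤ (1 + Real.log n) ^ q := one_le_pow₀ (by linarith)
      calc (1 : ℝ) = 1 * 1 * 1 := by norm_num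
        _ ≤ C * ((n : ℝ) ^ (-α) * 2 ^ k) * (1 + Real.log n) ^ q := by gcongr
        _ = _ := by ring
  set T : ℝ := C * (n : ℝ) ^ (-α) * (1 + Real.log n) ^ q with hT
  have hT0 : 0 ≤ T := by positivity
  have hpt : ∀ᵐ z ∂μ, ENNReal.ofReal ((n * p z) ^ j * Real.exp (-(a * (n * p z)))) ≤
      ∑' k : ℕ, {z | n * p z ≤ 2 ^ k}.indicator
        (fun _ => ENNReal.ofReal D * ENNReal.ofReal (4 * (1 / 4) ^ k)) z := by
    filter_upwards [hp0] with z hz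
    have hs : 0 ≤ n * p z := by positivity
    calc _ ≤ ENNReal.ofReal (D * ((1 + n * p z) ^ 2)⁻¹) :=
          ENNReal.ofReal_le_ofReal (pow_mul_exp_neg_le ha j hs)
      _ = ENNReal.ofReal D * ENNReal.ofReal ((1 + n * p z) ^ 2)⁻¹ := ENNReal.ofReal_mul hD0
      _ ≤ ENNReal.ofReal D * ∑' k : ℕ, {t : ℝ | t ≤ 2 ^ k}.indicator
            (fun _ => ENNReal.ofReal (4 * (1 / 4) ^ k)) (n * p z) :=
          mul_le_mul_right (inv_one_add_sq_le_tsum hs) _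
      _ = _ := by
          rw [← ENNReal.tsum_mul_left]
          refine tsum_congr fun k => ?_
          by_cases h : n * p z ≤ 2 ^ k
          · rw [Set.indicator_of_mem (by exact h), Set.indicator_of_mem (by exact h)]
          · rw [Set.indicator_of_notMem (by exact h), Set.indicator_of_notMem (by exact h),
              mul_zero]
  have hm : ∀ k : ℕ, MeasurableSet {z | n * p z ≤ 2 ^ k} := fun k =>
    measurableSet_le (by fun_prop) measurable_const
  calc _ ≤ _ := lintegral_mono_ae hpt
    _ = ∑' k : ℕ, ENNReal.ofReal D * ENNReal.ofReal (4 * (1 / 4) ^ k) * μ {z | n * p z ≤ 2 ^ k} := by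
        rw [lintegral_tsum fun k => (measurable_const.indicator (hm k)).aemeasurable]
        exact tsum_congr fun k => lintegral_indicator_const (hm k) _
    _ ≤ ∑' k : ℕ, ENNReal.ofReal (4 * D * T * (1 / 2) ^ k) := by
        refine ENNReal.tsum_le_tsum fun k => ?_
        calc _ ≤ ENNReal.ofReal D * ENNReal.ofReal (4 * (1 / 4) ^ k) *
              ENNReal.ofReal (T * 2 ^ k) := by gcongr; exact htail' k
          _ = _ := by
            rw [← ENNReal.ofReal_mul hD0, ← ENNReal.ofReal_mul (by positivity)]
            congr 1
            have : (1 / 4 : ℝ) ^ k * 2 ^ k = (1 / 2) ^ k := by rw [← mul_pow]; norm_num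
            rw [← this]
            ring
    _ = ENNReal.ofReal (4 * D * T * 2) := by
        rw [← ENNReal.ofReal_tsum_of_nonneg (fun k => by positivity)
          (summable_geometric_two.mul_left _), tsum_mul_left, tsum_geometric_two]
    _ = _ := by
        rw [hT]
        congr 1
        ring

open Classical in
theorem lintegral_faceCount_eq_sum {E : Type*} [NormedAddCommGroup E] [NormedSpace ℝ E]
    [FiniteDimensional ℝ E] [MeasurableSpace E] [BorelSpace E] {n j : ℕ}
    (ν : Measure (Fin n → E)) (hν : ∀ᵐ x ∂ν, InGeneralPosition x)
    (hn : Module.finrank ℝ E + 1 ≤ n) (hj : j < Module.finrank ℝ E) :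
    ∫⁻ x, (faceCount (convexHull ℝ (Set.range x)) j : ENNReal) ∂ν =
      ∑ J ∈ Finset.powersetCard (j + 1) (Finset.univ : Finset (Fin n)),
        ν {x | IsExposedIndexSet x J} := by
  have h : ∀ᵐ x ∂ν, (faceCount (convexHull ℝ (Set.range x)) j : ENNReal) =
      ∑ J ∈ Finset.powersetCard (j + 1) (Finset.univ : Finset (Fin n)),
        {x | IsExposedIndexSet x J}.indicator 1 x := by
    filter_upwards [hν] with x hx
    rw [hx.faceCount_eq (by simpa using hn) hj, Finset.card_filter]
    push_cast
    refine Finset.sum_congr rfl fun J _ => ?_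
    by_cases h : IsExposedIndexSet x J
    · rw [Set.indicator_of_mem (by exact h)]; simp [h]
    · rw [Set.indicator_of_notMem (by exact h)]; simp [h]
  rw [lintegral_congr_ae h, lintegral_finsetSum]
  · exact Finset.sum_congr rfl fun J _ => lintegral_indicator_one (measurableSet_isExposedIndexSet J)
  · exact fun J _ => measurable_one.indicator (measurableSet_isExposedIndexSet J)

variable {ι : Type*} [Fintype ι] [Nonempty ι] {V : ι → Type*} [∀ i, NormedAddCommGroup (V i)]
  [∀ i, InnerProductSpace ℝ (V i)] [∀ i, FiniteDimensional ℝ (V i)] [∀ i, Nontrivial (V i)]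
  [∀ i, MeasurableSpace (V i)] [∀ i, BorelSpace (V i)] {ν : Π i, Measure (V i)}
  [∀ i, IsProbabilityMeasure (ν i)] {γ c C : ι → ℝ}

theorem exists_lintegral_faceCount_le (hν : ∀ i, IsCapRegular (ν i) (γ i) (c i) (C i))
    (hγ : ∀ i, 0 ≤ γ i)
    (hgen : ∀ n, ∀ᵐ x ∂Measure.pi (fun _ : Fin n => Measure.pi ν), InGeneralPosition x)
    {α : ℝ} (hα : 0 ≤ α) (hα1 : α ≤ 1) {q : ℕ} {A : ℝ} (hA : 1 ≤ A)
    (htail : ∀ t : ℝ, 0 < t → t ≤ 1 → Measure.pi ν {z | boundaryProd γ z ≤ t} ≤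
      ENNReal.ofReal (A * t ^ α * (1 - Real.log t) ^ q))
    {j : ℕ} (hj : j < Module.finrank ℝ (Π i, V i)) :
    ∃ B > 0, ∀ n : ℕ, Module.finrank ℝ (Π i, V i) + 1 ≤ n →
      ∫⁻ x, (faceCount (convexHull ℝ (Set.range x)) j : ENNReal)
          ∂Measure.pi (fun _ : Fin n => Measure.pi ν) ≤
        ENNReal.ofReal (B * (n * (n : ℝ) ^ (-α) * (1 + Real.log n) ^ q)) := by
  have hc0 : 0 < ∏ i, c i := Finset.prod_pos fun i _ => (hν i).c_pos
  have hcard : (0 : ℝ) < Fintype.card ι := by exact_mod_cast Fintype.card_pos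
  have hC0 : 0 < ∏ i, C i * (128 * (Fintype.card ι : ℝ)) ^ γ i := Finset.prod_pos fun i _ =>
    mul_pos (hν i).C_pos (Real.rpow_pos_of_pos (by positivity) _)
  set B₁ : ℝ := (∏ i, c i)⁻¹ * (∏ i, C i * (128 * (Fintype.card ι : ℝ)) ^ γ i) ^ (j + 1) *
          Real.exp ((∏ i, c i) * (j + 1)) with hB₁
  have hB₁0 : 0 < B₁ := by positivity
  set B₂ : ℝ := ((j + 2).factorial * Real.exp (∏ i, c i) / (∏ i, c i) ^ (j + 2)) * 8 * A with hB₂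
  have hB₂0 : 0 < B₂ := by positivity
  refine ⟨B₁ * B₂, by positivity, fun n hn => ?_⟩
  have hn1 : 1 ≤ n := by omega
  have hn0 : (0 : ℝ) < n := by exact_mod_cast hn1
  rw [lintegral_faceCount_eq_sum _ (hgen n) hn hj]
  set I := ∫⁻ z, ENNReal.ofReal (boundaryProd γ z ^ j *
          Real.exp (-((∏ i, c i) * (n * boundaryProd γ z)))) ∂Measure.pi ν with hI
  have hI' : ENNReal.ofReal ((n : ℝ) ^ j) * I ≤
      ENNReal.ofReal (B₂ * (n : ℝ) ^ (-α) * (1 + Real.log n) ^ q) := by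
    rw [hI, ← lintegral_const_mul' _ _ ENNReal.ofReal_ne_top]
    refine le_trans (le_of_eq ?_) (lintegral_pow_mul_exp_neg_le (Measure.pi ν)
      (measurable_boundaryProd γ) ?_ hα hα1 hA htail hc0 j hn1)
    · refine lintegral_congr fun z => ?_
      rw [← ENNReal.ofReal_mul (by positivity)]
      congr 1
      ring
    · filter_upwards [ae_mem_regularPoints hν] with z hz using (boundaryProd_pos γ hz).le
  calc _ ≤ ∑ J ∈ Finset.powersetCard (j + 1) (Finset.univ : Finset (Fin n)),
        ENNReal.ofReal B₁ * I := Finset.sum_le_sum fun J hJ =>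
          measure_isExposedIndexSet_le hν hγ (Finset.mem_powersetCard.1 hJ).2
    _ = (n.choose (j + 1) : ENNReal) * (ENNReal.ofReal B₁ * I) := by
        rw [Finset.sum_const, Finset.card_powersetCard, nsmul_eq_mul]
        simp
    _ ≤ ENNReal.ofReal ((n : ℝ) ^ (j + 1)) * (ENNReal.ofReal B₁ * I) := by
        gcongr
        rw [← Nat.cast_pow, ENNReal.ofReal_natCast]
        exact_mod_cast Nat.choose_le_pow n (j + 1)
    _ = ENNReal.ofReal (n * B₁) * (ENNReal.ofReal ((n : ℝ) ^ j) * I) := by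
        rw [pow_succ, ENNReal.ofReal_mul (p := (n : ℝ) ^ j) (by positivity),
          ENNReal.ofReal_mul (p := (n : ℝ)) (q := B₁) (by positivity)]
        ring
    _ ≤ ENNReal.ofReal (n * B₁) *
        ENNReal.ofReal (B₂ * (n : ℝ) ^ (-α) * (1 + Real.log n) ^ q) := by gcongr
    _ = _ := by
        rw [← ENNReal.ofReal_mul (by positivity)]
        congr 1
        ring

end UpperBound

section LowerBound

set_option linter.unusedSectionVars false

variable {ι : Type*} [Fintype ι] [Nonempty ι] {V : ι → Type*} [∀ i, NormedAddCommGroup (V i)]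
  [∀ i, InnerProductSpace ℝ (V i)] [∀ i, FiniteDimensional ℝ (V i)] [∀ i, Nontrivial (V i)]
  [∀ i, MeasurableSpace (V i)] [∀ i, BorelSpace (V i)] {ν : Π i, Measure (V i)}
  [∀ i, IsProbabilityMeasure (ν i)] {γ c C : ι → ℝ}

theorem isExposedIndexSet_singleton {κ : Type*} {x : κ → Π i, V i} {k : κ}
    (hk : x k ∈ regularPoints V) (hx : ∀ l i, ‖x l i‖ ≤ 1)
    (h : ∀ l ≠ k, x l ∉ capProd (Fintype.card ι) (x k)) : IsExposedIndexSet x {k} := by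
  classical
  set u : Π i, V i := fun i => unitDir (x k i) with hu
  have hr : ∀ i, 0 < 1 - ‖x k i‖ := fun i => by linarith [(hk i).2]
  have hun : ∀ i, ‖u i‖ = 1 := fun i => norm_unitDir (hk i).1
  refine ⟨∑ i, (1 - ‖x k i‖)⁻¹ • (innerSL ℝ (u i)).comp (ContinuousLinearMap.proj i),
    ∑ i, (1 - ‖x k i‖)⁻¹ * inner ℝ (u i) (x k i), ?_, ?_⟩
  · intro l hl
    rw [Finset.mem_singleton] at hl
    subst hl
    simp
  · intro l hl
    rw [Finset.mem_singleton] at hl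
    have h1 := h l hl
    simp only [capProd, Set.mem_pi, Set.mem_univ, true_imp_iff, not_forall, ballCap,
      Set.mem_ofPred_eq, not_and, not_le] at h1
    obtain ⟨i, hi⟩ := h1
    have hi := hi (hx l i)
    have hz : ∀ i, inner ℝ (u i) (x k i) = ‖x k i‖ := fun i => by
      have : ‖x k i‖ ≠ 0 := norm_ne_zero_iff.2 (hk i).1
      simp only [hu, unitDir, real_inner_smul_left, real_inner_self_eq_norm_sq]
      field_simp
    have hsum : ∑ i, (1 - ‖x k i‖)⁻¹ * (1 - inner ℝ (u i) (x k i)) = Fintype.card ι := by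
      rw [Finset.sum_congr rfl fun i _ => by rw [hz i, inv_mul_cancel₀ (hr i).ne']]
      simp
    have hle : ∀ i, 0 ≤ (1 - ‖x k i‖)⁻¹ * (1 - inner ℝ (u i) (x l i)) := fun i => by
      have : inner ℝ (u i) (x l i) ≤ 1 := by
        calc _ ≤ ‖u i‖ * ‖x l i‖ := real_inner_le_norm _ _
          _ ≤ 1 * 1 := by rw [hun i]; gcongr; exact hx l i
          _ = 1 := one_mul 1
      have := hr i
      exact mul_nonneg (by positivity) (by linarith)
    have hlt : (Fintype.card ι : ℝ) < ∑ i, (1 - ‖x k i‖)⁻¹ * (1 - inner ℝ (u i) (x l i)) := by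
      refine lt_of_lt_of_le ?_ (Finset.single_le_sum (fun i _ => hle i) (Finset.mem_univ i))
      rw [inv_mul_eq_div, lt_div_iff₀ (hr i)]
      exact hi
    simp only [mul_sub, Finset.sum_sub_distrib, mul_one] at hsum hlt
    simp only [sum_apply, smul_apply,
      ContinuousLinearMap.comp_apply, ContinuousLinearMap.proj_apply, innerSL_apply_apply, smul_eq_mul]
    change ∑ i, (1 - ‖x k i‖)⁻¹ * inner ℝ (u i) (x l i) < _
    linarith

theorem exists_le_measure_isExposedIndexSet (hν : ∀ i, IsCapRegular (ν i) (γ i) (c i) (C i)) :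
    ∃ κ : ℝ, 0 < κ ∧ ∀ (n : ℕ) (k : Fin n),
      ENNReal.ofReal (1 / 2) * Measure.pi ν {z | boundaryProd γ z ≤ κ / n} ≤
        (Measure.pi fun _ : Fin n => Measure.pi ν) {x | IsExposedIndexSet x {k}} := by
  have hM : (0 : ℝ) < Fintype.card ι := by exact_mod_cast Fintype.card_pos
  set M : ℝ := ((Fintype.card ι : ℕ) : ℝ) with hMdef
  set A : ℝ := ∏ i, C i * M ^ γ i with hA
  have hA0 : 0 < A := Finset.prod_pos fun i _ =>
    mul_pos (hν i).C_pos (Real.rpow_pos_of_pos hM _)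
  set μ := Measure.pi ν with hμ
  refine ⟨1 / (2 * A), by positivity, fun n k => ?_⟩
  obtain ⟨N, rfl⟩ : ∃ N, n = N + 1 := ⟨n - 1, by have := k.pos; omega⟩
  set S : Set (Π i, V i) :=
    {z | boundaryProd γ z ≤ 1 / (2 * A) / ((N + 1 : ℕ) : ℝ)} ∩ regularPoints V with hS
  have hSm : MeasurableSet S :=
    (measurableSet_le (measurable_boundaryProd γ) measurable_const).inter
      measurableSet_regularPoints
  set Q : Set ((Π i, V i) × (Fin N → Π i, V i)) :=
    {w | w.1 ∈ S ∧ ∀ l, w.2 l ∉ capProd M w.1} with hQ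
  have hQm : MeasurableSet Q := by
    simp only [hQ, Set.ofPred_and, Set.ofPred_forall]
    exact (hSm.preimage measurable_fst).inter (MeasurableSet.iInter fun l =>
      ((measurableSet_mem_capProd l M).compl.preimage measurable_swap))
  have hmp := measurePreserving_piFinSuccAbove (fun _ : Fin (N + 1) => μ) k
  have hae : ∀ᵐ x ∂(Measure.pi fun _ : Fin (N + 1) => μ), ∀ l, x l ∈ regularPoints V := by
    rw [ae_all_iff]
    intro l
    exact (Measure.quasiMeasurePreserving_eval (fun _ : Fin (N + 1) => μ) l).ae
      (ae_mem_regularPoints hν)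
  have hsub : (MeasurableEquiv.piFinSuccAbove (fun _ : Fin (N + 1) => Π i, V i) k) ⁻¹' Q ≤ᵐ[
      Measure.pi fun _ : Fin (N + 1) => μ] {x | IsExposedIndexSet x {k}} := by
    filter_upwards [hae] with x hx hxQ
    obtain ⟨-, h2⟩ := hxQ
    refine isExposedIndexSet_singleton (hx k) (fun l i => (hx l i).2.le) fun l hl => ?_
    obtain ⟨l', rfl⟩ := Fin.exists_succAbove_eq hl
    exact h2 l'
  calc ENNReal.ofReal (1 / 2) * μ {z | boundaryProd γ z ≤ 1 / (2 * A) / ((N + 1 : ℕ) : ℝ)}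
      = ENNReal.ofReal (1 / 2) * μ S := by
        congr 1
        refine measure_congr ?_
        filter_upwards [ae_mem_regularPoints hν] with z hz
        exact propext ⟨fun h => ⟨h, hz⟩, fun h => h.1⟩
    _ = ∫⁻ z in S, ENNReal.ofReal (1 / 2) ∂μ := (setLIntegral_const _ _).symm
    _ ≤ ∫⁻ z in S, (Measure.pi fun _ : Fin N => μ) (Prod.mk z ⁻¹' Q) ∂μ := by
        refine setLIntegral_mono_ae' hSm (ae_of_all _ fun z hz => ?_)
        have hp := boundaryProd_pos γ hz.2
        set p := boundaryProd γ z with hpdef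
        have hp1 : (N + 1) * (A * p) ≤ 1 / 2 := by
          have h1 : p ≤ 1 / (2 * A) / ((N + 1 : ℕ) : ℝ) := hz.1
          rw [div_div, le_div_iff₀ (by positivity)] at h1
          push_cast at h1
          linarith
        have hp2 : A * p ≤ 1 / 2 := by
          have : 0 ≤ N * (A * p) := by positivity
          linarith
        have hcap : ENNReal.ofReal (1 - A * p) ≤ μ (capProd M z)ᶜ := by
          rw [prob_compl_eq_one_sub (isClosed_capProd M z).measurableSet,
            ENNReal.ofReal_sub _ (by positivity), ENNReal.ofReal_one]
          gcongr
          exact measure_capProd_le hν hM hz.2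
        have hb := one_add_mul_le_pow (a := -(A * p)) (by linarith) N
        calc ENNReal.ofReal (1 / 2) ≤ ENNReal.ofReal ((1 - A * p) ^ N) := by
              apply ENNReal.ofReal_le_ofReal
              rw [← sub_eq_add_neg] at hb
              refine le_trans ?_ hb
              have : 0 ≤ A * p := by positivity
              linarith
          _ = ENNReal.ofReal (1 - A * p) ^ N := ENNReal.ofReal_pow (by linarith) _
          _ ≤ μ (capProd M z)ᶜ ^ N := by gcongr
          _ = (Measure.pi fun _ : Fin N => μ) (Set.univ.pi fun _ => (capProd M z)ᶜ) := by
              rw [Measure.pi_pi]; simp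
          _ ≤ _ := measure_mono fun y hy => show (z, y) ∈ Q from
              ⟨hz, fun l => hy l trivial⟩
    _ ≤ ∫⁻ z, (Measure.pi fun _ : Fin N => μ) (Prod.mk z ⁻¹' Q) ∂μ := setLIntegral_le_lintegral _ _
    _ = (μ.prod (Measure.pi fun _ : Fin N => μ)) Q := (Measure.prod_apply hQm).symm
    _ = _ := (hmp.measure_preimage hQm.nullMeasurableSet).symm
    _ ≤ _ := measure_mono_ae hsub

theorem exists_le_lintegral_faceCount (hν : ∀ i, IsCapRegular (ν i) (γ i) (c i) (C i))
    (hgen : ∀ n, ∀ᵐ x ∂Measure.pi (fun _ : Fin n => Measure.pi ν), InGeneralPosition x) :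
    ∃ κ : ℝ, 0 < κ ∧ ∀ (n j : ℕ), Module.finrank ℝ (Π i, V i) + 1 ≤ n →
      j < Module.finrank ℝ (Π i, V i) →
      ENNReal.ofReal (n / 2) * Measure.pi ν {z | boundaryProd γ z ≤ κ / n} ≤
        (j + 1) * ∫⁻ x, (faceCount (convexHull ℝ (Set.range x)) j : ENNReal)
          ∂Measure.pi (fun _ : Fin n => Measure.pi ν) := by
  classical
  obtain ⟨κ, hκ, h⟩ := exists_le_measure_isExposedIndexSet hν
  refine ⟨κ, hκ, fun n j hn hj => ?_⟩
  have h1 : ∀ᵐ x ∂Measure.pi (fun _ : Fin n => Measure.pi ν),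
      ∑ k : Fin n, {x : Fin n → Π i, V i | IsExposedIndexSet x {k}}.indicator
        (1 : (Fin n → Π i, V i) → ENNReal) x ≤
      (j + 1) * (faceCount (convexHull ℝ (Set.range x)) j : ENNReal) := by
    filter_upwards [hgen n] with x hx
    have := hx.card_vertices_le (by simpa using hn) hj
    rw [Finset.card_filter] at this
    calc _ = ((∑ k : Fin n, if IsExposedIndexSet x {k} then 1 else 0 : ℕ) : ENNReal) := by
          push_cast
          refine Finset.sum_congr rfl fun k _ => ?_
          by_cases h : IsExposedIndexSet x {k}
          · rw [Set.indicator_of_mem (by exact h)]; simp [h]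
          · rw [Set.indicator_of_notMem (by exact h)]; simp [h]
      _ ≤ (((j + 1) * faceCount (convexHull ℝ (Set.range x)) j : ℕ) : ENNReal) := by
          exact_mod_cast this
      _ = _ := by push_cast; rfl
  calc _ = ∑ k : Fin n, ENNReal.ofReal (1 / 2) * Measure.pi ν {z | boundaryProd γ z ≤ κ / n} := by
        rw [Finset.sum_const, nsmul_eq_mul, Finset.card_univ, Fintype.card_fin, ← mul_assoc,
          ← ENNReal.ofReal_natCast, ← ENNReal.ofReal_mul (by positivity)]
        congr 2
        ring
    _ ≤ ∑ k : Fin n, (Measure.pi fun _ : Fin n => Measure.pi ν) {x | IsExposedIndexSet x {k}} :=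
        Finset.sum_le_sum fun k _ => h n k
    _ = ∫⁻ x, ∑ k : Fin n, {x : Fin n → Π i, V i | IsExposedIndexSet x {k}}.indicator
          (1 : (Fin n → Π i, V i) → ENNReal) x ∂Measure.pi (fun _ : Fin n => Measure.pi ν) := by
        rw [lintegral_finsetSum _ fun k _ =>
          measurable_one.indicator (measurableSet_isExposedIndexSet {k})]
        exact Finset.sum_congr rfl fun k _ =>
          (lintegral_indicator_one (measurableSet_isExposedIndexSet {k})).symm
    _ ≤ ∫⁻ x, (j + 1) * (faceCount (convexHull ℝ (Set.range x)) j : ENNReal)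
          ∂Measure.pi (fun _ : Fin n => Measure.pi ν) := lintegral_mono_ae h1
    _ = _ := lintegral_const_mul' _ _ (by finiteness)

end LowerBound

section ProductTail

theorem sum_exp_neg_mul_le {δ : ℝ} (hδ : 0 < δ) (N : ℕ) :
    ∑ l ∈ Finset.range N, Real.exp (-(δ * l)) ≤ (1 - Real.exp (-δ))⁻¹ := by
  have h1 : Real.exp (-δ) < 1 := Real.exp_lt_one_iff.2 (by linarith)
  have h2 : ∀ l : ℕ, Real.exp (-(δ * l)) = Real.exp (-δ) ^ l := fun l => by
    rw [← Real.exp_nat_mul]; congr 1; ring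
  simp_rw [h2]
  rw [← tsum_geometric_of_lt_one (Real.exp_pos _).le h1]
  exact (summable_geometric_of_lt_one (Real.exp_pos _).le h1).sum_le_tsum _
    fun _ _ => by positivity

variable {ι : Type*} [Fintype ι] {Ω : ι → Type*} [∀ i, MeasurableSpace (Ω i)]
  {ν : Π i, Measure (Ω i)} [∀ i, IsProbabilityMeasure (ν i)] {W : Π i, Ω i → ℝ} {α : ι → ℝ}
  {a : ℝ}

open Classical in
theorem exists_measure_prod_le (hW : ∀ i, ∀ᵐ y ∂ν i, 0 < W i y ∧ W i y ≤ 1) {C : ι → ℝ}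
    (hC : ∀ i, 0 < C i)
    (hU : ∀ i, ∀ t : ℝ, 0 < t → ν i {y | W i y ≤ t} ≤ ENNReal.ofReal (C i * t ^ α i))
    (ha : ∀ i, a ≤ α i) {i₀ : ι} (hi₀ : α i₀ = a) :
    ∃ A : ℝ, 1 ≤ A ∧ ∀ t : ℝ, 0 < t → t ≤ 1 → Measure.pi ν {z | ∏ i, W i (z i) ≤ t} ≤
      ENNReal.ofReal (A * t ^ a *
        (1 - Real.log t) ^ ((Finset.univ.filter fun i => α i = a).card - 1)) := by
  set S := Finset.univ.filter fun i => α i = a with hS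
  have hi₀S : i₀ ∈ S := by simp [hS, hi₀]
  have hq : S.card - 1 = (S.erase i₀).card := (Finset.card_erase_of_mem hi₀S).symm
  set G : ι → ℝ := fun i => if α i = a then 1 else (1 - Real.exp (-(α i - a)))⁻¹ with hG
  have hG0 : ∀ i, 0 < G i := fun i => by
    by_cases h : α i = a
    · simp [hG, h]
    · have h1 : Real.exp (-(α i - a)) < 1 :=
        Real.exp_lt_one_iff.2 (by have := lt_of_le_of_ne (ha i) (Ne.symm h); linarith)
      simp only [hG, h, if_false]
      exact inv_pos.2 (by linarith)
  have hG1 : ∀ i, 1 ≤ G i := fun i => by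
    by_cases h : α i = a
    · simp [hG, h]
    · have h1 : Real.exp (-(α i - a)) < 1 :=
        Real.exp_lt_one_iff.2 (by have := lt_of_le_of_ne (ha i) (Ne.symm h); linarith)
      simp only [hG, h, if_false]
      exact (one_le_inv₀ (by linarith)).2 (by linarith [Real.exp_pos (-(α i - a))])
  set B : ℝ := (∏ i, C i) * Real.exp (a * Fintype.card ι) * (∏ i, G i) * 2 ^ (S.erase i₀).card
    with hB
  have hPC : 0 < ∏ i, C i := Finset.prod_pos fun i _ => hC i
  have hPG : 0 < ∏ i, G i := Finset.prod_pos fun i _ => hG0 i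
  refine ⟨max 1 B, le_max_left _ _, fun t ht ht1 => ?_⟩
  rw [hq]
  have hT : 0 ≤ -Real.log t := by linarith [Real.log_nonpos ht.le ht1]
  set T : ℝ := -Real.log t with hTdef
  set N : ℕ := ⌈T⌉₊ with hN
  have hTN : T ≤ N := Nat.le_ceil T
  have hNT : (N : ℝ) + 1 ≤ 2 * (1 + T) := by linarith [Nat.ceil_lt_add_one hT]
  set K : ι → Finset ℕ := fun i => if i = i₀ then {0} else Finset.range (N + 1) with hK
  set L := Fintype.piFinset K with hL
  set box : (ι → ℕ) → Set (Π i, Ω i) := fun l => Set.univ.pi fun i =>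
    {y | W i y ≤ Real.exp (-l i) * if i = i₀ then t * Real.exp (Fintype.card ι + ∑ i, (l i : ℝ))
      else 1} with hbox
  have hae : ∀ᵐ z ∂Measure.pi ν, ∀ i, 0 < W i (z i) ∧ W i (z i) ≤ 1 := by
    rw [ae_all_iff]
    exact fun i => (Measure.quasiMeasurePreserving_eval ν i).ae (hW i)
  have hcover : {z | ∏ i, W i (z i) ≤ t} ≤ᵐ[Measure.pi ν] ⋃ l ∈ L, box l := by
    filter_upwards [hae] with z hz hzt
    have hzt : ∏ i, W i (z i) ≤ t := hzt
    set w : ι → ℝ := fun i => -Real.log (W i (z i)) with hw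
    have hw0 : ∀ i, 0 ≤ w i := fun i => by
      have := Real.log_nonpos (hz i).1.le (hz i).2
      simp only [hw]; linarith
    have hsum : T ≤ ∑ i, w i := by
      have := Real.log_le_log (Finset.prod_pos fun i _ => (hz i).1) hzt
      rw [Real.log_prod fun i _ => (hz i).1.ne'] at this
      simp only [hw, Finset.sum_neg_distrib]
      linarith
    set l : ι → ℕ := fun i => if i = i₀ then 0 else min ⌊w i⌋₊ N with hl
    have hlw : ∀ i, (l i : ℝ) ≤ w i := fun i => by
      by_cases h : i = i₀
      · simp only [hl, h, if_true, Nat.cast_zero]; exact hw0 _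
      · simp only [hl, h, if_false]
        exact (Nat.cast_le.2 (min_le_left _ _)).trans (Nat.floor_le (hw0 i))
    have hlL : l ∈ L := by
      rw [hL, Fintype.mem_piFinset]
      intro i
      by_cases h : i = i₀
      · simp [hl, hK, h]
      · simp only [hl, hK, h, if_false, Finset.mem_range]
        exact Nat.lt_succ_of_le (min_le_right _ _)
    have hexp : ∀ i, W i (z i) = Real.exp (-w i) := fun i => by
      simp only [hw, neg_neg]; rw [Real.exp_log (hz i).1]
    refine Set.mem_iUnion₂.2 ⟨l, hlL, fun i _ => ?_⟩
    simp only [Set.mem_ofPred_eq]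
    by_cases h : i = i₀
    · subst h
      have hli : l i = 0 := by simp [hl]
      rw [if_pos rfl, hli, hexp i]
      have hte : t = Real.exp (-T) := by rw [hTdef, neg_neg, Real.exp_log ht]
      rw [hte]
      simp only [Nat.cast_zero, neg_zero, Real.exp_zero, one_mul]
      rw [← Real.exp_add]
      apply Real.exp_le_exp.2
      by_cases hex : ∃ k, k ≠ i ∧ l k = N
      · obtain ⟨k, hk, hkN⟩ := hex
        have : (l k : ℝ) ≤ ∑ i, (l i : ℝ) :=
          Finset.single_le_sum (f := fun i => (l i : ℝ)) (fun i _ => Nat.cast_nonneg _)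
            (Finset.mem_univ k)
        rw [hkN] at this
        have h2 : (0 : ℝ) ≤ Fintype.card ι := Nat.cast_nonneg _
        linarith [hw0 i]
      · push Not at hex
        have hlt : ∀ k ∈ Finset.univ.erase i, w k ≤ l k + 1 := fun k hk => by
          have hk := Finset.ne_of_mem_erase hk
          have h1 := hex k hk
          simp only [hl, hk, if_false] at h1 ⊢
          have h2 : min ⌊w k⌋₊ N = ⌊w k⌋₊ := by
            rcases min_choice ⌊w k⌋₊ N with h3 | h3
            · exact h3
            · exact absurd h3 h1
          rw [h2]
          exact (Nat.lt_floor_add_one (w k)).le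
        have h3 := Finset.sum_le_sum hlt
        have h4 : ∑ k ∈ Finset.univ.erase i, ((l k : ℝ) + 1) ≤ ∑ k, ((l k : ℝ) + 1) :=
          Finset.sum_le_sum_of_subset_of_nonneg (Finset.erase_subset _ _)
            fun k _ _ => by positivity
        have h5 : ∑ k, ((l k : ℝ) + 1) = Fintype.card ι + ∑ k, (l k : ℝ) := by
          rw [Finset.sum_add_distrib]; simp [add_comm]
        have h6 := Finset.add_sum_erase Finset.univ w (Finset.mem_univ i)
        linarith
    · rw [if_neg h, mul_one, hexp i]
      exact Real.exp_le_exp.2 (by linarith [hlw i])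
  have hboxle : ∀ l ∈ L, Measure.pi ν (box l) ≤ ENNReal.ofReal
      ((∏ i, C i) * Real.exp (a * Fintype.card ι) * t ^ a *
        ∏ i, Real.exp (-((α i - a) * l i))) := by
    intro l hl
    have hl0 : l i₀ = 0 := by
      have := Fintype.mem_piFinset.1 hl i₀
      simpa [hK] using this
    rw [hbox, Measure.pi_pi]
    set b : ι → ℝ := fun i => Real.exp (-l i) *
      if i = i₀ then t * Real.exp (Fintype.card ι + ∑ i, (l i : ℝ)) else 1 with hb
    have hb0 : ∀ i, 0 < b i := fun i => by
      simp only [hb]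
      split_ifs <;> positivity
    calc _ ≤ ∏ i, ENNReal.ofReal (C i * b i ^ α i) :=
          Finset.prod_le_prod' fun i _ => hU i _ (hb0 i)
      _ = ENNReal.ofReal (∏ i, C i * b i ^ α i) :=
          (ENNReal.ofReal_prod_of_nonneg fun i _ =>
            mul_nonneg (hC i).le (Real.rpow_nonneg (hb0 i).le _)).symm
      _ = _ := by
          congr 1
          have e1 : ∀ i, b i ^ α i = Real.exp (-(α i * l i)) *
              (if i = i₀ then t ^ a * Real.exp (a * (Fintype.card ι + ∑ i, (l i : ℝ))) else 1) := by
            intro i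
            by_cases h : i = i₀
            · subst h
              simp only [hb, if_true, hl0, Nat.cast_zero, neg_zero, Real.exp_zero, one_mul,
                mul_zero]
              rw [Real.mul_rpow ht.le (Real.exp_pos _).le, hi₀, ← Real.exp_mul, mul_comm _ a]
            · simp only [hb, h, if_false, mul_one]
              rw [← Real.exp_mul]; congr 1; ring
          rw [Finset.prod_congr rfl fun i _ => by rw [e1 i], Finset.prod_mul_distrib,
            Finset.prod_mul_distrib, Finset.prod_ite_eq' Finset.univ i₀, if_pos (Finset.mem_univ _),
            ← Real.exp_sum, ← Real.exp_sum]
          have e2 : Real.exp (∑ i, -((α i - a) * l i)) =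
              Real.exp (∑ i, -(α i * l i)) * Real.exp (a * ∑ i, (l i : ℝ)) := by
            rw [← Real.exp_add, Finset.mul_sum, ← Finset.sum_add_distrib]
            congr 1
            exact Finset.sum_congr rfl fun i _ => by ring
          rw [e2, mul_add, Real.exp_add]
          ring
  have hsumle : ∀ i, ∑ l ∈ K i, Real.exp (-((α i - a) * l)) ≤
      G i * if i ∈ S.erase i₀ then (N + 1 : ℝ) else 1 := by
    intro i
    by_cases h : i = i₀
    · subst h
      simp only [hK, if_true, Finset.sum_singleton, Nat.cast_zero, mul_zero, neg_zero,
        Real.exp_zero, Finset.mem_erase, ne_eq, not_true_eq_false, false_and, if_false, mul_one]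
      exact hG1 i
    · by_cases h' : α i = a
      · have : i ∈ S.erase i₀ := by simp [hS, h, h']
        simp [hK, h, this, h', hG]
      · have : i ∉ S.erase i₀ := by simp [hS, h']
        simp only [hK, h, this, if_false, mul_one]
        simp only [hG, h', if_false]
        exact sum_exp_neg_mul_le (by
          have := lt_of_le_of_ne (ha i) (Ne.symm h'); linarith) _
  calc Measure.pi ν {z | ∏ i, W i (z i) ≤ t} ≤ Measure.pi ν (⋃ l ∈ L, box l) := measure_mono_ae hcover
    _ ≤ ∑ l ∈ L, Measure.pi ν (box l) := measure_biUnion_finset_le _ _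
    _ ≤ ∑ l ∈ L, ENNReal.ofReal ((∏ i, C i) * Real.exp (a * Fintype.card ι) * t ^ a *
        ∏ i, Real.exp (-((α i - a) * l i))) := Finset.sum_le_sum hboxle
    _ = ENNReal.ofReal ((∏ i, C i) * Real.exp (a * Fintype.card ι) * t ^ a *
          ∏ i, ∑ l ∈ K i, Real.exp (-((α i - a) * l))) := by
        rw [← ENNReal.ofReal_sum_of_nonneg fun l _ => by positivity, ← Finset.mul_sum,
          Finset.prod_univ_sum]
    _ ≤ _ := by
        apply ENNReal.ofReal_le_ofReal
        calc _ ≤ (∏ i, C i) * Real.exp (a * Fintype.card ι) * t ^ a *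
              ∏ i, (G i * if i ∈ S.erase i₀ then (N + 1 : ℝ) else 1) := by
              gcongr with i
              exact hsumle i
          _ = (∏ i, C i) * Real.exp (a * Fintype.card ι) * t ^ a *
              ((∏ i, G i) * (N + 1 : ℝ) ^ (S.erase i₀).card) := by
              rw [Finset.prod_mul_distrib, Finset.prod_ite_mem, Finset.univ_inter,
                Finset.prod_const]
          _ ≤ (∏ i, C i) * Real.exp (a * Fintype.card ι) * t ^ a *
              ((∏ i, G i) * (2 * (1 + T)) ^ (S.erase i₀).card) := by gcongr
          _ = B * t ^ a * (1 + T) ^ (S.erase i₀).card := by rw [mul_pow, hB]; ring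
          _ ≤ max 1 B * t ^ a * (1 + T) ^ (S.erase i₀).card := by gcongr; exact le_max_right _ _
          _ = _ := by rw [hTdef, ← sub_eq_add_neg]

open Classical in
theorem exists_le_measure_prod (hWm : ∀ i, Measurable (W i))
    (hW : ∀ i, ∀ᵐ y ∂ν i, 0 < W i y ∧ W i y ≤ 1) {c : ι → ℝ}
    (hc : ∀ i, 0 < c i) {m : ℝ} (hm : 0 < m)
    (hL : ∀ i, ∀ t : ℝ, 0 < t → t ≤ 1 →
      ENNReal.ofReal (c i * t ^ α i) ≤ ν i {y | t * Real.exp (-m) ≤ W i y ∧ W i y ≤ t})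
    {i₀ : ι} (hi₀ : α i₀ = a) :
    ∃ A : ℝ, 0 < A ∧ ∀ t : ℝ, 0 < t → t ≤ 1 →
      ENNReal.ofReal (A * t ^ a *
        (-Real.log t) ^ ((Finset.univ.filter fun i => α i = a).card - 1)) ≤
      Measure.pi ν {z | ∏ i, W i (z i) ≤ t} := by
  set S := Finset.univ.filter fun i => α i = a with hS
  have hi₀S : i₀ ∈ S := by simp [hS, hi₀]
  have hq : S.card - 1 = (S.erase i₀).card := (Finset.card_erase_of_mem hi₀S).symm
  have hcard : (0 : ℝ) < Fintype.card ι := by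
    have : Nonempty ι := ⟨i₀⟩
    exact_mod_cast Fintype.card_pos
  set M : ℝ := 2 * m * Fintype.card ι with hM
  have hM0 : 0 < M := by positivity
  have hPc : 0 < ∏ i ∈ S, c i := Finset.prod_pos fun i _ => hc i
  refine ⟨(∏ i ∈ S, c i) * (1 / M) ^ (S.erase i₀).card, by positivity, fun t ht ht1 => ?_⟩
  rw [hq]
  have hT : 0 ≤ -Real.log t := by linarith [Real.log_nonpos ht.le ht1]
  set T : ℝ := -Real.log t with hTdef
  have hte : t = Real.exp (-T) := by rw [hTdef, neg_neg, Real.exp_log ht]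
  set N : ℕ := ⌊T / M⌋₊ with hN
  have hNT : (N : ℝ) * M ≤ T := by
    rw [← le_div_iff₀ hM0]; exact Nat.floor_le (by positivity)
  have hTN : T / M ≤ N + 1 := (Nat.lt_floor_add_one _).le
  set K : ι → Finset ℕ := fun i => if i ∈ S.erase i₀ then Finset.range (N + 1) else {0} with hK
  set L := Fintype.piFinset K with hLdef
  set r : (ι → ℕ) → ι → ℝ := fun l i => Real.exp (-(2 * m * l i)) *
    if i = i₀ then t * Real.exp (2 * m * ∑ i, (l i : ℝ)) else 1 with hr
  set box : (ι → ℕ) → Set (Π i, Ω i) := fun l => Set.univ.pi fun i =>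
    if i ∈ S then {y | r l i * Real.exp (-m) ≤ W i y ∧ W i y ≤ r l i} else Set.univ with hbox
  have hl0 : ∀ l ∈ L, ∀ i, i ∉ S.erase i₀ → l i = 0 := fun l hl i hi => by
    have := Fintype.mem_piFinset.1 hl i
    simp only [hK, hi, if_false, Finset.mem_singleton] at this
    exact this
  have hlN : ∀ l ∈ L, ∀ i, l i ≤ N := fun l hl i => by
    by_cases hi : i ∈ S.erase i₀
    · have := Fintype.mem_piFinset.1 hl i
      simp only [hK, hi, if_true, Finset.mem_range] at this
      omega
    · rw [hl0 l hl i hi]; exact Nat.zero_le _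
  have hr0 : ∀ l i, 0 < r l i := fun l i => by
    simp only [hr]
    split_ifs <;> positivity
  have hr1 : ∀ l ∈ L, ∀ i, r l i ≤ 1 := fun l hl i => by
    by_cases h : i = i₀
    · subst h
      have h0 : l i = 0 := hl0 l hl i (by simp)
      simp only [hr, if_true, h0, Nat.cast_zero, mul_zero, neg_zero, Real.exp_zero, one_mul]
      rw [hte, ← Real.exp_add]
      refine Real.exp_le_one_iff.2 ?_
      have : ∑ i, (l i : ℝ) ≤ Fintype.card ι * N := by
        rw [← nsmul_eq_mul, ← Finset.card_univ]
        exact Finset.sum_le_card_nsmul _ _ _ fun i _ => by exact_mod_cast hlN l hl i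
      have h2 : 2 * m * ∑ i, (l i : ℝ) ≤ 2 * m * (Fintype.card ι * N) := by gcongr
      have h3 : 2 * m * (Fintype.card ι * N) = N * M := by rw [hM]; ring
      linarith
    · simp only [hr, h, if_false, mul_one]
      exact Real.exp_le_one_iff.2 (by have : (0:ℝ) ≤ 2 * m * l i := by positivity
                                      linarith)
  have hae : ∀ᵐ z ∂Measure.pi ν, ∀ i, 0 < W i (z i) ∧ W i (z i) ≤ 1 := by
    rw [ae_all_iff]
    exact fun i => (Measure.quasiMeasurePreserving_eval ν i).ae (hW i)
  have hsub : (⋃ l ∈ L, box l) ≤ᵐ[Measure.pi ν] {z | ∏ i, W i (z i) ≤ t} := by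
    filter_upwards [hae] with z hz hzl
    obtain ⟨l, hl, hzl⟩ := Set.mem_iUnion₂.1 hzl
    have h1 : ∀ i, W i (z i) ≤ r l i := fun i => by
      by_cases hi : i ∈ S
      · have := hzl i trivial
        simp only [hi, if_true] at this
        exact this.2
      · have hne : i ≠ i₀ := fun h => hi (h ▸ hi₀S)
        have h0 : l i = 0 := hl0 l hl i fun h => hi (Finset.mem_of_mem_erase h)
        simp only [hr, hne, if_false, h0, Nat.cast_zero, mul_zero, neg_zero, Real.exp_zero, mul_one]
        exact (hz i).2
    calc ∏ i, W i (z i) ≤ ∏ i, r l i := Finset.prod_le_prod (fun i _ => (hz i).1.le) fun i _ => h1 i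
      _ = t := by
          simp only [hr]
          rw [Finset.prod_mul_distrib, Finset.prod_ite_eq' Finset.univ i₀,
            if_pos (Finset.mem_univ _), ← Real.exp_sum, Finset.sum_neg_distrib, ← Finset.mul_sum,
            mul_left_comm, ← Real.exp_add, neg_add_cancel, Real.exp_zero, mul_one]
  have hboxm : ∀ l, MeasurableSet (box l) := fun l => by
    refine MeasurableSet.univ_pi fun i => ?_
    split_ifs
    · exact (measurableSet_le measurable_const (hWm i)).inter
        (measurableSet_le (hWm i) measurable_const)
    · exact MeasurableSet.univ
  have hdisj : (L : Set (ι → ℕ)).PairwiseDisjoint box := by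
    have key : ∀ l ∈ L, ∀ l' ∈ L, ∀ i, l i < l' i → Disjoint (box l) (box l') := by
      intro l hl l' hl' i hi
      rw [Set.disjoint_left]
      intro z hz hz'
      have hiS : i ∈ S.erase i₀ := by
        by_contra h
        rw [hl0 l' hl' i h] at hi
        omega
      have hne := Finset.ne_of_mem_erase hiS
      have h1 := hz i trivial
      have h2 := hz' i trivial
      simp only [Finset.mem_of_mem_erase hiS, if_true, hr, hne, if_false, mul_one] at h1 h2
      have h3 := h1.1.trans h2.2
      rw [← Real.exp_add, Real.exp_le_exp] at h3
      have h4 : (l i : ℝ) + 1 ≤ l' i := by exact_mod_cast hi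
      nlinarith
    intro l hl l' hl' hne
    obtain ⟨i, hi⟩ := Function.ne_iff.1 hne
    rcases lt_or_gt_of_ne hi with h | h
    · exact key l hl l' hl' i h
    · exact (key l' hl' l hl i h).symm
  have hboxle : ∀ l ∈ L, ENNReal.ofReal ((∏ i ∈ S, c i) * t ^ a) ≤ Measure.pi ν (box l) := by
    intro l hl
    rw [hbox, Measure.pi_pi]
    have e1 : ∏ i, ν i (if i ∈ S then {y | r l i * Real.exp (-m) ≤ W i y ∧ W i y ≤ r l i}
        else Set.univ) =
        ∏ i ∈ S, ν i {y | r l i * Real.exp (-m) ≤ W i y ∧ W i y ≤ r l i} := by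
      rw [← Finset.prod_subset (Finset.subset_univ S) fun i _ hi => by simp [hi]]
      exact Finset.prod_congr rfl fun i hi => by rw [if_pos hi]
    rw [e1]
    calc _ = ENNReal.ofReal (∏ i ∈ S, c i * r l i ^ α i) := by
          congr 1
          rw [Finset.prod_mul_distrib]
          congr 1
          have e2 : ∀ i ∈ S, r l i ^ α i = (r l i) ^ a := fun i hi => by
            rw [(Finset.mem_filter.1 hi).2]
          rw [Finset.prod_congr rfl e2, Real.finsetProd_rpow _ _ fun i _ => (hr0 l i).le]
          congr 1
          simp only [hr]
          rw [Finset.prod_mul_distrib, Finset.prod_ite_eq' S i₀,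
            if_pos hi₀S, ← Real.exp_sum, Finset.sum_neg_distrib, ← Finset.mul_sum]
          have e3 : ∑ i, (l i : ℝ) = ∑ i ∈ S, (l i : ℝ) := by
            refine (Finset.sum_subset (Finset.subset_univ S) fun i _ hi => ?_).symm
            rw [hl0 l hl i fun h => hi (Finset.mem_of_mem_erase h), Nat.cast_zero]
          rw [e3, mul_left_comm, ← Real.exp_add, neg_add_cancel, Real.exp_zero, mul_one]
      _ = ∏ i ∈ S, ENNReal.ofReal (c i * r l i ^ α i) :=
          ENNReal.ofReal_prod_of_nonneg fun i _ =>
            mul_nonneg (hc i).le (Real.rpow_nonneg (hr0 l i).le _)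
      _ ≤ _ := Finset.prod_le_prod' fun i _ => hL i _ (hr0 l i) (hr1 l hl i)
  have hLcard : L.card = (N + 1) ^ (S.erase i₀).card := by
    rw [hLdef, Fintype.card_piFinset]
    have : ∀ i, (K i).card = if i ∈ S.erase i₀ then N + 1 else 1 := fun i => by
      simp only [hK]
      split_ifs <;> simp
    rw [Finset.prod_congr rfl fun i _ => this i, Finset.prod_ite_mem, Finset.univ_inter,
      Finset.prod_const]
  calc _ ≤ ENNReal.ofReal (((N + 1 : ℕ) : ℝ) ^ (S.erase i₀).card * ((∏ i ∈ S, c i) * t ^ a)) := by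
        apply ENNReal.ofReal_le_ofReal
        calc _ = (T / M) ^ (S.erase i₀).card * ((∏ i ∈ S, c i) * t ^ a) := by
              rw [div_eq_mul_one_div T M, mul_pow]; ring
          _ ≤ _ := by gcongr; push_cast; exact hTN
    _ = ∑ l ∈ L, ENNReal.ofReal ((∏ i ∈ S, c i) * t ^ a) := by
        rw [Finset.sum_const, hLcard, nsmul_eq_mul, ← ENNReal.ofReal_natCast,
          ← ENNReal.ofReal_mul (by positivity)]
        push_cast
        rfl
    _ ≤ ∑ l ∈ L, Measure.pi ν (box l) := Finset.sum_le_sum hboxle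
    _ = Measure.pi ν (⋃ l ∈ L, box l) := (measure_biUnion_finset hdisj fun l _ => hboxm l).symm
    _ ≤ _ := measure_mono_ae hsub

end ProductTail

section BlockBeta

theorem betaDensity_le_betaConst {β : ℝ} (hβ : 0 ≤ β) (k : ℕ) (y : EuclideanSpace ℝ (Fin k)) :
    betaDensity β k y ≤ betaConst β k := by
  have hc := betaConst_pos hβ k
  rw [betaDensity]
  split_ifs with h
  · refine mul_le_of_le_one_right hc.le (Real.rpow_le_one ?_ ?_ hβ)
    · nlinarith [norm_nonneg y]
    · nlinarith [norm_nonneg y]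
  · exact hc.le

theorem betaMeasure_le_volume {β : ℝ} (hβ : 0 ≤ β) (k : ℕ) (s : Set (EuclideanSpace ℝ (Fin k))) :
    betaMeasure β k s ≤ ENNReal.ofReal (betaConst β k) * volume s :=
  betaMeasure_le_of_density_le fun y _ => betaDensity_le_betaConst hβ k y

theorem exists_isCapRegular_betaMeasure {β : ℝ} (hβ : 0 ≤ β) {k : ℕ} (hk : 1 ≤ k) :
    ∃ c C : ℝ, IsCapRegular (betaMeasure β k) (β + ((k : ℝ) + 1) / 2) c C := by
  obtain ⟨C, hC, hC'⟩ := betaMeasure_ballCap_le hβ hk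
  obtain ⟨c, hc, hc'⟩ := le_betaMeasure_inner_cap hβ hk
  have hne : Nonempty (Fin k) := ⟨⟨0, hk⟩⟩
  have hnull : ∀ s : Set (EuclideanSpace ℝ (Fin k)), volume s = 0 → betaMeasure β k s = 0 :=
    fun s hs => le_antisymm ((betaMeasure_le_volume hβ k s).trans (by rw [hs, mul_zero])) zero_le
  refine ⟨c, C, hc, hC, ?_, ?_, hC', hc'⟩
  · have h1 : betaMeasure β k (Metric.sphere 0 1) = 0 := hnull _ (Measure.addHaar_sphere _ _ _)
    have h2 : betaMeasure β k {y | 1 < ‖y‖} = 0 := by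
      refine le_antisymm ((betaMeasure_le_of_density_le (D := 0) fun y hy => ?_).trans
        (by simp)) zero_le
      have hy : 1 < ‖y‖ := hy
      rw [betaDensity, if_neg (not_le.2 hy)]
    refine measure_mono_null (fun y hy => ?_) (measure_union_null h1 h2)
    have hy : ¬ ‖y‖ < 1 := hy
    rcases (not_lt.1 hy).eq_or_lt with h | h
    · exact Or.inl (by simp [← h])
    · exact Or.inr h
  · have hnt : Nontrivial (EuclideanSpace ℝ (Fin k)) :=
      Module.nontrivial_of_finrank_pos (R := ℝ) (by rw [finrank_euclideanSpace_fin]; omega)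
    refine measure_mono_null (fun y hy => ?_) (hnull {0} (measure_singleton 0))
    simpa using hy

theorem exists_betaMeasure_rpow_le {β : ℝ} (hβ : 0 ≤ β) {k : ℕ} (hk : 1 ≤ k) {γ : ℝ} (hγ : 0 < γ) :
    ∃ C : ℝ, 0 < C ∧ ∀ t : ℝ, 0 < t → betaMeasure β k {y | (1 - ‖y‖) ^ γ ≤ t} ≤
      ENNReal.ofReal (C * t ^ ((β + 1) / γ)) := by
  obtain ⟨C, hC, h⟩ := betaMeasure_tail_le hβ hk
  refine ⟨C, hC, fun t ht => ?_⟩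
  have ht' : 0 < t ^ γ⁻¹ := Real.rpow_pos_of_pos ht _
  refine (measure_mono fun y hy => ?_).trans ((h (t ^ γ⁻¹) ht').trans (le_of_eq ?_))
  · have hy : (1 - ‖y‖) ^ γ ≤ t := hy
    rcases le_or_gt 0 (1 - ‖y‖) with h0 | h0
    · exact (Real.le_rpow_inv_iff_of_pos h0 ht.le hγ).2 hy
    · exact (h0.trans ht').le
  · rw [← Real.rpow_mul ht.le]
    congr 3
    rw [inv_mul_eq_div]

theorem exists_le_betaMeasure_rpow {β : ℝ} (hβ : 0 ≤ β) {k : ℕ} (hk : 1 ≤ k) {γ m : ℝ} (hγ : 0 < γ)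
    (hm : γ ≤ m) :
    ∃ c : ℝ, 0 < c ∧ ∀ t : ℝ, 0 < t → t ≤ 1 → ENNReal.ofReal (c * t ^ ((β + 1) / γ)) ≤
      betaMeasure β k {y | t * Real.exp (-m) ≤ (1 - ‖y‖) ^ γ ∧ (1 - ‖y‖) ^ γ ≤ t} := by
  obtain ⟨c, hc, h⟩ := le_betaMeasure_shell hβ hk
  refine ⟨c, hc, fun t ht ht1 => ?_⟩
  have ht' : 0 < t ^ γ⁻¹ := Real.rpow_pos_of_pos ht _
  have htt : (t ^ γ⁻¹) ^ γ = t := Real.rpow_inv_rpow ht.le hγ.ne'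
  refine (le_of_eq ?_).trans ((h (t ^ γ⁻¹) ht'
    (Real.rpow_le_one ht.le ht1 (inv_nonneg.2 hγ.le))).trans (measure_mono fun y hy => ?_))
  · rw [← Real.rpow_mul ht.le]
    congr 3
    rw [inv_mul_eq_div]
  · have h0 : 0 ≤ 1 - ‖y‖ := le_trans (by positivity) hy.1
    constructor
    · calc t * Real.exp (-m) ≤ t * (1 / 2) ^ γ := by
            gcongr
            rw [Real.rpow_def_of_pos (by norm_num)]
            apply Real.exp_le_exp.2
            have h2 : Real.log (1 / 2) = -Real.log 2 := by rw [one_div, Real.log_inv]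
            have h3 : Real.log 2 ≤ 1 := by linarith [Real.log_two_lt_d9]
            rw [h2]
            nlinarith
        _ = (t ^ γ⁻¹ / 2) ^ γ := by
            rw [div_eq_mul_one_div (t ^ γ⁻¹), Real.mul_rpow ht'.le (by norm_num), htt]
        _ ≤ _ := Real.rpow_le_rpow (by positivity) hy.1 hγ.le
    · calc _ ≤ (t ^ γ⁻¹) ^ γ := Real.rpow_le_rpow h0 hy.2 hγ.le
        _ = t := htt

variable {m : ℕ} {dv : Fin m → ℕ} {βv : Fin m → ℝ}

theorem blockBetaMeasure_affineSubspace (hβ : ∀ i, 0 ≤ βv i)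
    (A : AffineSubspace ℝ (Π i, EuclideanSpace ℝ (Fin (dv i)))) (hA : A ≠ ⊤)
    [∀ i, IsProbabilityMeasure (betaMeasure (βv i) (dv i))] :
    blockBetaMeasure dv βv A = 0 := by
  set D : ENNReal := 1 + ∑ i, ENNReal.ofReal (betaConst (βv i) (dv i)) with hD
  have hD0 : D ≠ 0 := by simp [hD]
  have hDt : D ≠ ⊤ := by
    rw [hD]
    exact ENNReal.add_ne_top.2 ⟨ENNReal.one_ne_top,
      (ENNReal.sum_lt_top.2 fun i _ => ENNReal.ofReal_lt_top).ne⟩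
  have h := measure_pi_le_of_le (fun i => betaMeasure (βv i) (dv i)) (fun _ => volume) hD0 hDt
    fun i s => (betaMeasure_le_volume (hβ i) (dv i) s).trans (by
      gcongr
      exact (Finset.single_le_sum (f := fun i => ENNReal.ofReal (betaConst (βv i) (dv i)))
        (fun _ _ => zero_le) (Finset.mem_univ i)).trans le_add_self)
  refine le_antisymm ((h A).trans ?_) zero_le
  rw [Measure.smul_apply, ← volume_pi, Measure.addHaar_affineSubspace _ A hA, smul_zero]

theorem ae_inGeneralPosition_blockBetaMeasure (hβ : ∀ i, 0 ≤ βv i) (hdv : ∀ i, 1 ≤ dv i)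
    (hm : 1 ≤ m) (n : ℕ) :
    ∀ᵐ x ∂Measure.pi (fun _ : Fin n => blockBetaMeasure dv βv), InGeneralPosition x := by
  have hp : ∀ i, IsProbabilityMeasure (betaMeasure (βv i) (dv i)) := fun i =>
    isProbabilityMeasure_betaMeasure (hβ i) (hdv i)
  have hnt : ∀ i, Nontrivial (EuclideanSpace ℝ (Fin (dv i))) := fun i =>
    Module.nontrivial_of_finrank_pos (R := ℝ)
      (by rw [finrank_euclideanSpace_fin]; exact hdv i)
  have hne : Nonempty (Fin m) := ⟨⟨0, hm⟩⟩
  have hprob : IsProbabilityMeasure (blockBetaMeasure dv βv) := by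
    unfold blockBetaMeasure; infer_instance
  have := Pi.nontrivial_at (f := fun i => EuclideanSpace ℝ (Fin (dv i))) (⟨0, hm⟩ : Fin m)
  exact ae_inGeneralPosition (blockBetaMeasure dv βv) (fun A hA => blockBetaMeasure_affineSubspace hβ A hA) n

theorem ofReal_expectedFaceCount (hβ : ∀ i, 0 ≤ βv i) (hdv : ∀ i, 1 ≤ dv i) (hm : 1 ≤ m)
    {j n : ℕ} (hn : ∑ i, dv i + 1 ≤ n) (hj : j < ∑ i, dv i)
    (hfin : ∫⁻ x, (faceCount (convexHull ℝ (Set.range x)) j : ENNReal)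
      ∂Measure.pi (fun _ : Fin n => blockBetaMeasure dv βv) ≠ ⊤) :
    ENNReal.ofReal (expectedFaceCount dv βv j n) =
      ∫⁻ x, (faceCount (convexHull ℝ (Set.range x)) j : ENNReal)
        ∂Measure.pi (fun _ : Fin n => blockBetaMeasure dv βv) := by
  have hd : Module.finrank ℝ (Π i, EuclideanSpace ℝ (Fin (dv i))) = ∑ i, dv i := by
    rw [Module.finrank_pi_fintype]; simp
  have hmeas := aemeasurable_faceCount (j := j) _
    (ae_inGeneralPosition_blockBetaMeasure hβ hdv hm n) (by rw [hd]; exact hn) (by rw [hd]; exact hj)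
  rw [expectedFaceCount, integral_eq_lintegral_of_nonneg_ae
    (ae_of_all _ fun x => Nat.cast_nonneg _)
    hmeas.aestronglyMeasurable]
  simp only [ENNReal.ofReal_natCast]
  exact ENNReal.ofReal_toReal hfin

open Classical in
theorem exists_expectedFaceCount_bounds (hβ : ∀ i, 0 ≤ βv i) (hdv : ∀ i, 1 ≤ dv i) {a : ℝ}
    (ha : IsLeast (Set.range fun i => (βv i + 1) / (βv i + ((dv i : ℝ) + 1) / 2)) a) {q : ℕ}
    (hq : q = (Finset.univ.filter fun i =>
      (βv i + 1) / (βv i + ((dv i : ℝ) + 1) / 2) = a).card - 1) :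
    (∀ j < ∑ i, dv i, ∃ B : ℝ, 0 < B ∧ ∀ n : ℕ, ∑ i, dv i + 1 ≤ n →
      expectedFaceCount dv βv j n ≤ B * (n * (n : ℝ) ^ (-a) * (1 + Real.log n) ^ q)) ∧
    ∃ κ : ℝ, 0 < κ ∧ ∃ A : ℝ, 0 < A ∧ ∀ j < ∑ i, dv i, ∀ n : ℕ, ∑ i, dv i + 1 ≤ n → κ ≤ n →
      n / 2 * (A * (κ / n) ^ a * (Real.log n - Real.log κ) ^ q) ≤
        (j + 1) * expectedFaceCount dv βv j n := by
  obtain ⟨i₀, hi₀⟩ := ha.1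
  have hm : 1 ≤ m := i₀.pos
  have hne : Nonempty (Fin m) := ⟨i₀⟩
  have hdv' : ∀ i, (1 : ℝ) ≤ dv i := fun i => by exact_mod_cast hdv i
  have hp : ∀ i, IsProbabilityMeasure (betaMeasure (βv i) (dv i)) := fun i =>
    isProbabilityMeasure_betaMeasure (hβ i) (hdv i)
  have hnt : ∀ i, Nontrivial (EuclideanSpace ℝ (Fin (dv i))) := fun i =>
    Module.nontrivial_of_finrank_pos (R := ℝ)
      (by rw [finrank_euclideanSpace_fin]; exact hdv i)
  have hd : Module.finrank ℝ (Π i, EuclideanSpace ℝ (Fin (dv i))) = ∑ i, dv i := by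
    rw [Module.finrank_pi_fintype]; simp
  set γ : Fin m → ℝ := fun i => βv i + ((dv i : ℝ) + 1) / 2 with hγ
  have hγ0 : ∀ i, 0 < γ i := fun i => by
    have := hβ i; have := hdv' i; simp only [hγ]; linarith
  choose c C hν using fun i => exists_isCapRegular_betaMeasure (hβ i) (hdv i)
  have hgen := ae_inGeneralPosition_blockBetaMeasure hβ hdv hm
  set W : Π i, EuclideanSpace ℝ (Fin (dv i)) → ℝ := fun i y => (1 - ‖y‖) ^ γ i with hWdef
  have hWm : ∀ i, Measurable (W i) := fun i => by simp only [hWdef]; fun_prop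
  have hW : ∀ i, ∀ᵐ y ∂betaMeasure (βv i) (dv i), 0 < W i y ∧ W i y ≤ 1 := fun i => by
    filter_upwards [(hν i).norm_lt_one] with y hy
    exact ⟨Real.rpow_pos_of_pos (by linarith) _,
      Real.rpow_le_one (by linarith) (by linarith [norm_nonneg y]) (hγ0 i).le⟩
  choose C' hC' hU using fun i => exists_betaMeasure_rpow_le (hβ i) (hdv i) (hγ0 i)
  set M : ℝ := ∑ i, γ i with hM
  have hM0 : 0 < M := Finset.sum_pos (fun i _ => hγ0 i) Finset.univ_nonempty
  choose c' hc' hL using fun i => exists_le_betaMeasure_rpow (hβ i) (hdv i) (hγ0 i)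
    (Finset.single_le_sum (fun i _ => (hγ0 i).le) (Finset.mem_univ i) : γ i ≤ M)
  have ha0 : 0 ≤ a := by
    rw [← hi₀]; exact div_nonneg (by linarith [hβ i₀]) (hγ0 i₀).le
  have ha1 : a ≤ 1 := by
    rw [← hi₀]; exact (div_le_one (hγ0 i₀)).2 (by simp only [hγ]; linarith [hdv' i₀])
  obtain ⟨A, hA, hAt⟩ := exists_measure_prod_le (a := a) hW hC' hU
    (fun i => ha.2 ⟨i, rfl⟩) hi₀
  obtain ⟨A', hA', hAt'⟩ := exists_le_measure_prod (a := a) hWm hW hc' hM0 hL hi₀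
  have hupper : ∀ j < ∑ i, dv i, ∃ B : ℝ, 0 < B ∧ ∀ n : ℕ, ∑ i, dv i + 1 ≤ n →
      ∫⁻ x, (faceCount (convexHull ℝ (Set.range x)) j : ENNReal)
          ∂Measure.pi (fun _ : Fin n => blockBetaMeasure dv βv) ≤
        ENNReal.ofReal (B * (n * (n : ℝ) ^ (-a) * (1 + Real.log n) ^ q)) := fun j hj => by
    have := exists_lintegral_faceCount_le (q := q) hν (fun i => (hγ0 i).le) hgen ha0 ha1 hA
      (by rw [hq]; exact hAt) (j := j) (by rw [hd]; exact hj)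
    rw [hd] at this
    exact this
  constructor
  · intro j hj
    obtain ⟨B, hB, h⟩ := hupper j hj
    refine ⟨B, hB, fun n hn => ?_⟩
    have h1 := h n hn
    rw [← ofReal_expectedFaceCount hβ hdv hm hn hj (ne_top_of_le_ne_top ENNReal.ofReal_ne_top h1)]
      at h1
    have hn1 : (1 : ℝ) ≤ n := by exact_mod_cast (by omega : 1 ≤ n)
    have := Real.log_nonneg hn1
    exact (ENNReal.ofReal_le_ofReal_iff (by positivity)).1 h1
  · obtain ⟨κ, hκ, h⟩ := exists_le_lintegral_faceCount hν hgen
    refine ⟨κ, hκ, A', hA', fun j hj n hn hκn => ?_⟩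
    obtain ⟨B, hB, hfin⟩ := hupper j hj
    have h1 := h n j (by rw [hd]; exact hn) (by rw [hd]; exact hj)
    have hn0 : (0 : ℝ) < n := hκ.trans_le hκn
    have h2 := hAt' (κ / n) (by positivity) ((div_le_one hn0).2 hκn)
    have h3 : -Real.log (κ / n) = Real.log n - Real.log κ := by
      rw [Real.log_div hκ.ne' hn0.ne']; ring
    rw [h3, ← hq] at h2
    have h4 := ofReal_expectedFaceCount hβ hdv hm hn hj
      (ne_top_of_le_ne_top ENNReal.ofReal_ne_top (hfin n hn))
    have hE : 0 ≤ expectedFaceCount dv βv j n := integral_nonneg fun x => Nat.cast_nonneg _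
    have h5 : ENNReal.ofReal (n / 2 * (A' * (κ / n) ^ a * (Real.log n - Real.log κ) ^ q)) ≤
        ENNReal.ofReal ((j + 1) * expectedFaceCount dv βv j n) := by
      rw [ENNReal.ofReal_mul (p := (n : ℝ) / 2) (by positivity),
        ENNReal.ofReal_mul (p := (j : ℝ) + 1) (by positivity), h4]
      refine (mul_le_mul_right h2 _).trans (h1.trans (le_of_eq ?_))
      congr 1
      rw [ENNReal.ofReal_add (by positivity) (by positivity), ENNReal.ofReal_natCast,
        ENNReal.ofReal_one]
    exact (ENNReal.ofReal_le_ofReal_iff (by positivity)).1 h5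

end BlockBeta

theorem block_exponent_eq {b t : ℝ} (hb : 0 ≤ b) (ht : 1 ≤ t) :
    (b + 1) / (b + (t + 1) / 2) = 2 / ((t + b) / (1 + b) + 1) := by
  have h1 : (0 : ℝ) < 1 + b := by linarith
  have h2 : 0 < b + (t + 1) / 2 := by linarith
  have h3 : 0 < (t + b) / (1 + b) + 1 := by positivity
  rw [div_eq_div_iff h2.ne' h3.ne']
  field_simp
  ring

theorem mul_rpow_neg_eq_rpow {x k : ℝ} (hx : 0 < x) (hk : 0 ≤ k) :
    x * x ^ (-(2 / (k + 1))) = x ^ ((k - 1) / (k + 1)) := by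
  nth_rewrite 1 [← Real.rpow_one x]
  rw [← Real.rpow_add hx]
  congr 1
  field_simp
  ring

/-- A sequence eventually between two bounds has its lower and upper limits between them. -/
theorem le_liminf_and_limsup_le {u : ℕ → ℝ} {c C : ℝ} (h : ∀ᶠ n in atTop, c ≤ u n)
    (h' : ∀ᶠ n in atTop, u n ≤ C) : c ≤ liminf u atTop ∧ limsup u atTop ≤ C :=
  ⟨le_liminf_of_le (IsBoundedUnder.isCoboundedUnder_ge ⟨C, h'⟩) h,
    limsup_le_of_le (IsBoundedUnder.isCoboundedUnder_le ⟨c, h⟩) h'⟩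

/-- **Corollary 1.2 (A)**: for every `j ∈ {⌊d/2⌋−1, …, d−1}` the expected number of
`j`-faces of the random block-beta polytope satisfies
`E f_j(P_n^β) ≍ n^{(k_max−1)/(k_max+1)} (ln n)^{#k_max−1}`, with implied constants
depending only on the model parameters. -/
theorem expected_faces_block_beta
    (d m : ℕ) (hd : 2 ≤ d) (hm : 1 ≤ m) (hmd : m ≤ d)
    (dv : Fin m → ℕ) (hdv : ∀ i, 1 ≤ dv i) (hsum : ∑ i, dv i = d)
    (βv : Fin m → ℝ) (hβ : ∀ i, 0 ≤ βv i)
    (k : Fin m → ℝ) (hk : ∀ i, k i = ((dv i : ℝ) + βv i) / (1 + βv i))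
    (kmax : ℝ) (hkmax : IsGreatest (Set.range k) kmax)
    (nkmax : ℕ) (hnkmax : nkmax = (Finset.univ.filter fun i => k i = kmax).card) :
    ∃ c C : ℝ, 0 < c ∧ c ≤ C ∧
      ∀ j : ℕ, d / 2 - 1 ≤ j → j ≤ d - 1 →
        c ≤ liminf (fun n : ℕ => expectedFaceCount dv βv j n /
              ((n : ℝ) ^ ((kmax - 1) / (kmax + 1)) * Real.log n ^ (nkmax - 1))) atTop ∧
        limsup (fun n : ℕ => expectedFaceCount dv βv j n /
              ((n : ℝ) ^ ((kmax - 1) / (kmax + 1)) * Real.log n ^ (nkmax - 1))) atTop ≤ C := by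
  classical
  have hdv' : ∀ i, (1 : ℝ) ≤ dv i := fun i => by exact_mod_cast hdv i
  have hk0 : ∀ i, 0 < k i := fun i => by
    rw [hk]
    exact div_pos (by linarith [hβ i, hdv' i]) (by linarith [hβ i])
  have hα : ∀ i, (βv i + 1) / (βv i + ((dv i : ℝ) + 1) / 2) = 2 / (k i + 1) := fun i => by
    rw [hk, block_exponent_eq (hβ i) (hdv' i)]
  obtain ⟨⟨i₀, hi₀⟩, hmax⟩ := hkmax
  have hkm : 0 < kmax := hi₀ ▸ hk0 i₀
  set a : ℝ := 2 / (kmax + 1) with ha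
  have hleast : IsLeast (Set.range fun i => (βv i + 1) / (βv i + ((dv i : ℝ) + 1) / 2)) a := by
    refine ⟨⟨i₀, by simp only [hα, hi₀, ha]⟩, ?_⟩
    rintro _ ⟨i, rfl⟩
    simp only [hα, ha]
    have := hk0 i
    have : k i ≤ kmax := hmax ⟨i, rfl⟩
    gcongr
  have hq : nkmax - 1 = (Finset.univ.filter fun i =>
      (βv i + 1) / (βv i + ((dv i : ℝ) + 1) / 2) = a).card - 1 := by
    rw [hnkmax]
    congr 2
    ext i
    have := hk0 i
    simp only [Finset.mem_filter, Finset.mem_univ, true_and, hα, ha]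
    rw [div_eq_div_iff (by positivity) (by positivity), mul_right_inj' two_ne_zero,
      add_left_inj, eq_comm]
  set q := nkmax - 1
  obtain ⟨hup, κ, hκ, A, hA, hlow⟩ := exists_expectedFaceCount_bounds hβ hdv hleast hq
  rw [hsum] at hup hlow
  choose! B hB hup using hup
  have hd0 : (0 : ℝ) < d := by exact_mod_cast (by omega : 0 < d)
  set c : ℝ := A * κ ^ a / (2 * 2 ^ q * d) with hc
  have hκa : 0 < κ ^ a := Real.rpow_pos_of_pos hκ a
  refine ⟨c, max c (∑ j ∈ Finset.range d, B j * 2 ^ q), by positivity, le_max_left _ _, ?_⟩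
  intro j _ hj
  have hjd : j < d := by omega
  have hlog : Tendsto (fun n : ℕ => Real.log n) atTop atTop :=
    Real.tendsto_log_atTop.comp tendsto_natCast_atTop_atTop
  have hpow : ∀ n : ℕ, 0 < (n : ℝ) →
      (n : ℝ) ^ ((kmax - 1) / (kmax + 1)) = n * (n : ℝ) ^ (-a) := fun n hn =>
    (mul_rpow_neg_eq_rpow hn hkm.le).symm
  refine le_liminf_and_limsup_le ?_ ?_
  · filter_upwards [eventually_ge_atTop (d + 1), hlog.eventually_ge_atTop 1,
      hlog.eventually_ge_atTop (2 * Real.log κ),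
      tendsto_natCast_atTop_atTop.eventually_ge_atTop κ] with n hn hn1 hn2 hnκ
    have hn0 : (0 : ℝ) < n := hκ.trans_le hnκ
    have hna : 0 < (n : ℝ) ^ a := Real.rpow_pos_of_pos hn0 a
    have hj1 : ((j : ℝ) + 1) ≤ d := by exact_mod_cast hjd
    have hE : 0 ≤ expectedFaceCount dv βv j n := integral_nonneg fun x => Nat.cast_nonneg _
    rw [hpow n hn0, le_div_iff₀ (by positivity)]
    have h1 := (hlow j hjd n hn hnκ).trans (mul_le_mul_of_nonneg_right hj1 hE)
    have h2 : (Real.log n / 2) ^ q ≤ (Real.log n - Real.log κ) ^ q :=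
      pow_le_pow_left₀ (by linarith) (by linarith) q
    have h3 : n / 2 * (A * (κ / n) ^ a * (Real.log n / 2) ^ q) ≤
        d * expectedFaceCount dv βv j n := by
      refine le_trans ?_ h1
      gcongr
    refine le_of_mul_le_mul_left (le_trans (le_of_eq ?_) h3) hd0
    rw [hc, Real.rpow_neg hn0.le, Real.div_rpow hκ.le hn0.le, div_pow]
    field_simp
  · filter_upwards [eventually_ge_atTop (d + 1), hlog.eventually_ge_atTop 1] with n hn hn1
    have hn0 : (0 : ℝ) < n := by exact_mod_cast (by omega : 0 < n)
    rw [hpow n hn0, div_le_iff₀ (by positivity)]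
    have hsumB : B j * 2 ^ q ≤ max c (∑ j ∈ Finset.range d, B j * 2 ^ q) :=
      (Finset.single_le_sum (f := fun j => B j * 2 ^ q)
        (fun i hi => mul_nonneg (hB i (Finset.mem_range.1 hi)).le (by positivity))
        (Finset.mem_range.2 hjd)).trans (le_max_right _ _)
    have hBj := hB j hjd
    calc expectedFaceCount dv βv j n
        ≤ B j * (n * (n : ℝ) ^ (-a) * (1 + Real.log n) ^ q) := hup j hjd n hn
      _ ≤ B j * (n * (n : ℝ) ^ (-a) * (2 * Real.log n) ^ q) := by
          gcongr
          linarith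
      _ = B j * 2 ^ q * (n * (n : ℝ) ^ (-a) * Real.log n ^ q) := by
          rw [mul_pow]; ring
      _ ≤ _ := mul_le_mul_of_nonneg_right hsumB (by positivity)
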